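/- arXiv:2103.10705 — 9 statements merged into one kernel-verified Lean document; each statement's English description precedes it below -/
import Mathlib

section
/- Assume vol(V) > 0. For any S ⊆ V, let x ∈ ℝⁿ be the vector with x_i = 1 for i ∈ S and x_i = −1 for i ∉ S. Then ‖x‖_∞ = 1, I(x) = 2·cut(S), N(x) = 2·min(vol(S), vol(V∖S)), and consequently F(x) = I(x)/(2·vol(V)·‖x‖_∞ − N(x)) = cut(S)/max(vol(S), vol(V∖S)). -/
open Finset

noncomputable section

/-- Degree `d_i = ∑_j w_{ij}`. -/
def dvec (n : ℕ) (w : Fin n → Fin n → ℝ) (i : Fin n) : ℝ := ∑ j, w i j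

/-- Volume of a vertex subset: `vol(A) = ∑_{i ∈ A} d_i`. -/
def vol (n : ℕ) (w : Fin n → Fin n → ℝ) (A : Finset (Fin n)) : ℝ := ∑ i ∈ A, dvec n w i

/-- Cut value: `cut(S) = ∑_{i ∈ S} ∑_{j ∉ S} w_{ij}`. -/
def cut (n : ℕ) (w : Fin n → Fin n → ℝ) (S : Finset (Fin n)) : ℝ := ∑ i ∈ S, ∑ j ∈ Sᶜ, w i j

/-- `I(x) = ∑_{i<j} w_{ij} |x_i - x_j|`. -/
def Ifun (n : ℕ) (w : Fin n → Fin n → ℝ) (x : Fin n → ℝ) : ℝ :=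
  ∑ i, ∑ j, if i < j then w i j * |x i - x j| else 0

/-- `N(x) = min_{c ∈ ℝ} ∑_i d_i |x_i - c|`. -/
def Nfun (n : ℕ) (d : Fin n → ℝ) (x : Fin n → ℝ) : ℝ :=
  sInf (Set.range fun c : ℝ => ∑ i, d i * |x i - c|)

/-- The anti-Cheeger objective `F(x) = I(x) / (2 vol(V) ‖x‖_∞ - N(x))`.
Note `‖x‖` on `Fin n → ℝ` is the sup norm `‖x‖_∞ = max_i |x_i|`. -/
def Ffun (n : ℕ) (w : Fin n → Fin n → ℝ) (x : Fin n → ℝ) : ℝ :=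
  Ifun n w x / (2 * vol n w univ * ‖x‖ - Nfun n (dvec n w) x)

/-- `Q_r(x) = (I(x) + r N(x)) / (2 vol(V))`. -/
def Qfun (n : ℕ) (w : Fin n → Fin n → ℝ) (r : ℝ) (x : Fin n → ℝ) : ℝ :=
  (Ifun n w x + r * Nfun n (dvec n w) x) / (2 * vol n w univ)

/-- The subdifferential of `f : ℝⁿ → ℝ` at `x`:
all `s` with `f y ≥ f x + ⟨s, y - x⟩` for all `y`. -/
def subgrad (n : ℕ) (f : (Fin n → ℝ) → ℝ) (x : Fin n → ℝ) : Set (Fin n → ℝ) :=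
  {s | ∀ y, f y ≥ f x + ∑ i, s i * (y i - x i)}

/-- `‖x‖_p = (∑_i |x_i|^p)^{1/p}`. -/
def pnorm (n : ℕ) (p : ℝ) (x : Fin n → ℝ) : ℝ := (∑ i, |x i| ^ p) ^ (1 / p)

/-- A double sum vanishing on the diagonal is a sum over pairs `i < j`. -/
theorem sum_sum_eq_sum_sum_lt {ι M : Type*} [Fintype ι] [LinearOrder ι] [AddCommMonoid M]
    (f : ι → ι → M) (hf : ∀ i, f i i = 0) :
    ∑ i, ∑ j, f i j = ∑ i, ∑ j, if i < j then f i j + f j i else 0 := by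
  have hsplit : ∀ i j, f i j = (if i < j then f i j else 0) + (if j < i then f i j else 0) := by
    intro i j
    rcases lt_trichotomy i j with h | rfl | h
    · simp [h, h.not_gt]
    · simp [hf]
    · simp [h, h.not_gt]
  calc ∑ i, ∑ j, f i j
      = (∑ i, ∑ j, if i < j then f i j else 0) + ∑ i, ∑ j, if j < i then f i j else 0 := by
        simp only [← sum_add_distrib, ← hsplit]
    _ = (∑ i, ∑ j, if i < j then f i j else 0) + ∑ i, ∑ j, if i < j then f j i else 0 := by
        rw [sum_comm (f := fun i j => if j < i then f i j else 0)]
    _ = ∑ i, ∑ j, if i < j then f i j + f j i else 0 := by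
        simp only [← sum_add_distrib]
        refine sum_congr rfl fun i _ => sum_congr rfl fun j _ => ?_
        split_ifs <;> simp

theorem vol_add_vol_compl (n : ℕ) (w : Fin n → Fin n → ℝ) (S : Finset (Fin n)) :
    vol n w S + vol n w Sᶜ = vol n w univ :=
  sum_add_sum_compl S _

theorem vol_nonneg {n : ℕ} {w : Fin n → Fin n → ℝ} (hnn : ∀ i j, 0 ≤ w i j)
    (A : Finset (Fin n)) : 0 ≤ vol n w A :=
  sum_nonneg fun i _ => sum_nonneg fun j _ => hnn i j

theorem norm_signVector {n : ℕ} (hn : 1 ≤ n) {S : Finset (Fin n)} {x : Fin n → ℝ}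
    (hx : ∀ i, x i = if i ∈ S then 1 else -1) : ‖x‖ = 1 := by
  have habs : ∀ i, ‖x i‖ = 1 := by
    intro i
    rw [hx]
    split_ifs <;> simp
  refine le_antisymm ((pi_norm_le_iff_of_nonneg zero_le_one).2 fun i => (habs i).le) ?_
  exact (habs ⟨0, hn⟩).ge.trans (norm_le_pi_norm x _)

theorem Ifun_signVector {n : ℕ} {w : Fin n → Fin n → ℝ} (hsymm : ∀ i j, w i j = w j i)
    {S : Finset (Fin n)} {x : Fin n → ℝ} (hx : ∀ i, x i = if i ∈ S then 1 else -1) :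
    Ifun n w x = 2 * cut n w S := by
  have hcut : cut n w S = ∑ i, ∑ j, if i ∈ S ∧ j ∉ S then w i j else 0 := by
    simp only [cut, ite_and, ← mem_compl (s := S)]
    simp [sum_ite, filter_notMem_eq_sdiff, compl_eq_univ_sdiff]
  rw [hcut, sum_sum_eq_sum_sum_lt _ (by simp), Ifun, mul_sum]
  refine sum_congr rfl fun i _ => ?_
  rw [mul_sum]
  refine sum_congr rfl fun j _ => ?_
  rw [hx i, hx j, hsymm j i]
  by_cases hi : i ∈ S <;> by_cases hj : j ∈ S <;> by_cases hij : i < j <;>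
    norm_num [hi, hj, hij, mul_comm]

theorem sum_dvec_mul_abs_signVector_sub {n : ℕ} (w : Fin n → Fin n → ℝ)
    {S : Finset (Fin n)} {x : Fin n → ℝ} (hx : ∀ i, x i = if i ∈ S then 1 else -1) (c : ℝ) :
    ∑ i, dvec n w i * |x i - c| = vol n w S * |1 - c| + vol n w Sᶜ * |-1 - c| := by
  rw [← sum_add_sum_compl S, vol, vol, sum_mul, sum_mul]
  congr 1 <;> refine sum_congr rfl fun i hi => ?_
  · rw [hx, if_pos hi]
  · rw [hx, if_neg (mem_compl.1 hi)]

theorem Nfun_signVector {n : ℕ} {w : Fin n → Fin n → ℝ} (hnn : ∀ i j, 0 ≤ w i j)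
    {S : Finset (Fin n)} {x : Fin n → ℝ} (hx : ∀ i, x i = if i ∈ S then 1 else -1) :
    Nfun n (dvec n w) x = 2 * min (vol n w S) (vol n w Sᶜ) := by
  refine IsLeast.csInf_eq ⟨?_, ?_⟩
  · rcases le_total (vol n w S) (vol n w Sᶜ) with h | h
    · refine ⟨-1, ?_⟩
      simp only [sum_dvec_mul_abs_signVector_sub w hx, min_eq_left h]
      norm_num [mul_comm]
    · refine ⟨1, ?_⟩
      simp only [sum_dvec_mul_abs_signVector_sub w hx, min_eq_right h]
      norm_num [mul_comm]
  · rintro _ ⟨c, rfl⟩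
    simp only [sum_dvec_mul_abs_signVector_sub w hx]
    have hmin : 0 ≤ min (vol n w S) (vol n w Sᶜ) := le_min (vol_nonneg hnn _) (vol_nonneg hnn _)
    have habs : 2 ≤ |1 - c| + |-1 - c| := by
      linarith [le_abs_self (1 - c), neg_le_abs (-1 - c)]
    calc 2 * min (vol n w S) (vol n w Sᶜ)
        ≤ min (vol n w S) (vol n w Sᶜ) * (|1 - c| + |-1 - c|) := by
          rw [mul_comm]
          gcongr
      _ ≤ vol n w S * |1 - c| + vol n w Sᶜ * |-1 - c| := by
          rw [mul_add]
          gcongr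
          · exact min_le_left _ _
          · exact min_le_right _ _

/-- for the ±1 vector associated with a cut `(S, Sᶜ)`,
`‖x‖_∞ = 1`, `I(x) = 2 cut(S)`, `N(x) = 2 min(vol S, vol Sᶜ)` and
`F(x) = cut(S) / max(vol S, vol Sᶜ)`. -/
theorem stmt1 (n : ℕ) (hn : 1 ≤ n) (w : Fin n → Fin n → ℝ)
    (hsymm : ∀ i j, w i j = w j i) (hnn : ∀ i j, 0 ≤ w i j)
    (hdiag : ∀ i, w i i = 0) (hvol : 0 < vol n w univ)
    (S : Finset (Fin n)) (x : Fin n → ℝ)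
    (hxdef : ∀ i, x i = if i ∈ S then 1 else -1) :
    ‖x‖ = 1 ∧
    Ifun n w x = 2 * cut n w S ∧
    Nfun n (dvec n w) x = 2 * min (vol n w S) (vol n w Sᶜ) ∧
    Ffun n w x = cut n w S / max (vol n w S) (vol n w Sᶜ) := by
  have hN := Nfun_signVector hnn hxdef
  have hI := Ifun_signVector hsymm hxdef
  have hnorm := norm_signVector hn hxdef
  refine ⟨hnorm, hI, hN, ?_⟩
  have hden : 2 * vol n w univ * 1 - 2 * min (vol n w S) (vol n w Sᶜ)
      = 2 * max (vol n w S) (vol n w Sᶜ) := by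
    linarith [vol_add_vol_compl n w S, min_add_max (vol n w S) (vol n w Sᶜ)]
  rw [Ffun, hI, hN, hnorm, hden, mul_div_mul_left _ _ two_ne_zero]
end
end

section
/- Assume vol(V) > 0, and let M = max_{S ⊆ V} cut(S)/((1/2)·vol(V)) be the maxcut value. If M > 0 and the anti-Cheeger cut value equals the maxcut value, i.e. max_{S ⊆ V} cut(S)/max(vol(S), vol(V∖S)) = M, then there exists S* ⊆ V attaining the maxcut maximum, cut(S*)/((1/2)·vol(V)) = M, which is perfectly balanced: vol(S*) = vol(V∖S*) = (1/2)·vol(V). -/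
open Finset

noncomputable section

/-- if the anti-Cheeger cut value equals the (positive) maxcut value `M`,
then some maxcut maximizer `S*` is perfectly balanced. -/
theorem stmt4 (n : ℕ) (hn : 1 ≤ n) (w : Fin n → Fin n → ℝ)
    (hsymm : ∀ i j, w i j = w j i) (hnn : ∀ i j, 0 ≤ w i j)
    (hdiag : ∀ i, w i i = 0) (hvol : 0 < vol n w univ)
    (M : ℝ) (hM : M = ⨆ S : Finset (Fin n), cut n w S / ((1 / 2) * vol n w univ))
    (hMpos : 0 < M)
    (heq : (⨆ S : Finset (Fin n), cut n w S / max (vol n w S) (vol n w Sᶜ)) = M) :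
    ∃ Sstar : Finset (Fin n),
      cut n w Sstar / ((1 / 2) * vol n w univ) = M ∧
      vol n w Sstar = (1 / 2) * vol n w univ ∧
      vol n w Sstarᶜ = (1 / 2) * vol n w univ := by
  obtain ⟨S, hS⟩ := exists_eq_ciSup_of_finite
    (f := fun S : Finset (Fin n) => cut n w S / max (vol n w S) (vol n w Sᶜ))
  have hSM : cut n w S / max (vol n w S) (vol n w Sᶜ) = M := hS.trans heq
  have hle : cut n w S / ((1 / 2) * vol n w univ) ≤ M := by
    rw [hM]
    exact le_ciSup (f := fun S : Finset (Fin n) => cut n w S / ((1 / 2) * vol n w univ))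
      (Set.finite_range _).bddAbove S
  have hadd : vol n w S + vol n w Sᶜ = vol n w univ := sum_add_sum_compl S _
  have hl := le_max_left (vol n w S) (vol n w Sᶜ)
  have hr := le_max_right (vol n w S) (vol n w Sᶜ)
  generalize max (vol n w S) (vol n w Sᶜ) = m at hSM hl hr
  have hm : 0 < m := by linarith
  have hcut : cut n w S = M * m := (div_eq_iff hm.ne').mp hSM
  rw [div_le_iff₀ (by linarith), hcut] at hle
  have hmle : m ≤ 1 / 2 * vol n w univ := le_of_mul_le_mul_left hle hMpos
  have hmeq : m = 1 / 2 * vol n w univ := by linarith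
  exact ⟨S, by rw [← hmeq, hSM], by linarith, by linarith⟩
end
end

section
/- Let x ∈ ℝⁿ and let σ be a permutation of {1,…,n} such that x_{σ(1)} ≤ x_{σ(2)} ≤ … ≤ x_{σ(n)}. Define u ∈ ℝⁿ by u_i = Σ_{j≠i} w_{ij}·sign(σ⁻¹(i) − σ⁻¹(j)), where sign(t) = 1 for t > 0 and sign(t) = −1 for t < 0. Then u is a subgradient of I at x, i.e. u ∈ ∂I(x). -/
open Finset

noncomputable section

/-- Summation by parts over ordered pairs for an antisymmetric kernel. -/
theorem sum_antisymm_mul {n : ℕ} (a : Fin n → Fin n → ℝ) (ha : ∀ i j, a j i = -a i j)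
    (v : Fin n → ℝ) :
    ∑ i, (∑ j, a i j) * v i = ∑ i, ∑ j, if i < j then a i j * (v i - v j) else 0 := by
  have hsplit : ∀ i j, a i j * v i =
      (if i < j then a i j * v i else 0) + (if j < i then a i j * v i else 0) := by
    intro i j
    rcases lt_trichotomy i j with h | rfl | h
    · simp [h, h.not_gt]
    · have := ha i i
      have h0 : a i i = 0 := by linarith
      simp [h0]
    · simp [h, h.not_gt]
  simp_rw [sum_mul]
  rw [sum_congr rfl fun i _ => sum_congr rfl fun j _ => hsplit i j]
  simp_rw [sum_add_distrib]
  rw [sum_comm (f := fun i j => if j < i then a i j * v i else 0)]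
  simp_rw [← sum_add_distrib]
  refine sum_congr rfl fun i _ => sum_congr rfl fun j _ => ?_
  split_ifs
  · rw [ha i j]; ring
  · ring

/-- if `σ` sorts `x` increasingly, then
`u_i = ∑_{j ≠ i} w_{ij} sign(σ⁻¹(i) - σ⁻¹(j))` is a subgradient of `I` at `x`. -/
theorem stmt7 (n : ℕ) (hn : 1 ≤ n) (w : Fin n → Fin n → ℝ)
    (hsymm : ∀ i j, w i j = w j i) (hnn : ∀ i j, 0 ≤ w i j)
    (hdiag : ∀ i, w i i = 0) (x : Fin n → ℝ)
    (σ : Equiv.Perm (Fin n))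
    (hσ : ∀ i j : Fin n, i ≤ j → x (σ i) ≤ x (σ j))
    (u : Fin n → ℝ)
    (hu : ∀ i, u i = ∑ j ∈ univ.filter (fun j => j ≠ i),
        w i j * (if σ.symm j < σ.symm i then (1 : ℝ) else -1)) :
    u ∈ subgrad n (Ifun n w) x := by
  set a : Fin n → Fin n → ℝ :=
    fun i j => w i j * (if σ.symm j < σ.symm i then (1 : ℝ) else -1) with ha
  have hanti : ∀ i j, a j i = -a i j := by
    intro i j
    rcases lt_trichotomy (σ.symm i) (σ.symm j) with h | h | h
    · simp [ha, h, h.not_gt, hsymm j i]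
    · obtain rfl := σ.symm.injective h
      simp [ha, hdiag]
    · simp [ha, h, h.not_gt, hsymm j i]
  have hua : ∀ i, u i = ∑ j, a i j := by
    intro i
    rw [hu i]
    refine sum_subset (filter_subset _ _) fun j _ hj => ?_
    obtain rfl : j = i := by simpa using hj
    simp [hdiag]
  intro y
  simp_rw [hua]
  rw [sum_antisymm_mul a hanti, ge_iff_le, Ifun, Ifun, ← sum_add_distrib]
  refine sum_le_sum fun i _ => ?_
  rw [← sum_add_distrib]
  refine sum_le_sum fun j _ => ?_
  split_ifs
  · by_cases h : σ.symm j < σ.symm i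
    · have hx : x j ≤ x i := by simpa using hσ _ _ h.le
      have := mul_le_mul_of_nonneg_left (le_abs_self (y i - y j)) (hnn i j)
      simp only [ha, if_pos h, abs_of_nonneg (sub_nonneg.2 hx)]
      linarith
    · have hx : x i ≤ x j := by simpa using hσ _ _ (not_lt.1 h)
      have := mul_le_mul_of_nonneg_left (neg_le_abs (y i - y j)) (hnn i j)
      simp only [ha, if_neg h, abs_of_nonpos (sub_nonpos.2 hx)]
      linarith
  · simp
end
end

section
/- Assume d_i > 0 for every i. Let x ∈ ℝⁿ and let α be any minimizer of c ↦ Σ_{i=1}^n d_i|x_i − c|. Set A = Σ_{j : x_j < α} d_j − Σ_{j : x_j > α} d_j and B = Σ_{j : x_j = α} d_j, and define v ∈ ℝⁿ by v_i = d_i·sign(x_i − α) if x_i ≠ α (sign(t) = 1 for t > 0, −1 for t < 0) and v_i = (A/B)·d_i if x_i = α. Then v is a subgradient of N at x, i.e. v ∈ ∂N(x). -/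
open Finset

noncomputable section

/-- First-order optimality from the right of a weighted median. -/
theorem sum_weight_right_le_of_isMin {ι : Type*} [Fintype ι] (d x : ι → ℝ) (α : ℝ)
    (hα : ∀ c : ℝ, ∑ i, d i * |x i - α| ≤ ∑ i, d i * |x i - c|) :
    ∑ i with α < x i, d i ≤ ∑ i with x i < α, d i + ∑ i with x i = α, d i := by
  have hev : ∀ᶠ ε in nhdsWithin (0 : ℝ) (Set.Ioi 0), ∀ i, α < x i → ε < x i - α := by
    refine Filter.eventually_all.2 fun i => ?_
    by_cases hi : α < x i
    · filter_upwards [Ioo_mem_nhdsGT (sub_pos.2 hi)] with ε hε _ using hε.2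
    · exact Filter.Eventually.of_forall fun ε h => absurd h hi
  obtain ⟨ε, hlt, hε⟩ := (hev.and self_mem_nhdsWithin).exists
  have hε : 0 < ε := hε
  have hsum : ∑ i, d i * |x i - (α + ε)| = ∑ i, d i * |x i - α| +
      ε * (∑ i with x i < α, d i + ∑ i with x i = α, d i - ∑ i with α < x i, d i) := by
    simp only [sum_filter, ← sum_add_distrib, ← sum_sub_distrib, mul_sum]
    refine sum_congr rfl fun i _ => ?_
    rcases lt_trichotomy (x i) α with h | h | h
    · rw [if_pos h, if_neg h.ne, if_neg h.not_gt, abs_of_neg (by linarith),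
        abs_of_neg (by linarith)]
      ring
    · subst h
      simp [abs_of_pos hε, mul_comm]
    · have := hlt i h
      rw [if_neg h.not_gt, if_neg h.ne', if_pos h, abs_of_pos (by linarith),
        abs_of_pos (by linarith)]
      ring
  have h := hα (α + ε)
  rw [hsum] at h
  have := nonneg_of_mul_nonneg_right (le_add_iff_nonneg_right _ |>.1 h) hε
  linarith

/-- First-order optimality from the left of a weighted median. -/
theorem sum_weight_left_le_of_isMin {ι : Type*} [Fintype ι] (d x : ι → ℝ) (α : ℝ)
    (hα : ∀ c : ℝ, ∑ i, d i * |x i - α| ≤ ∑ i, d i * |x i - c|) :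
    ∑ i with x i < α, d i ≤ ∑ i with α < x i, d i + ∑ i with x i = α, d i := by
  have habs (a b : ℝ) : |-a - b| = |a - -b| := by
    rw [← abs_neg]
    congr 1
    ring
  simpa using sum_weight_right_le_of_isMin d (fun i => -x i) (-α) fun c => by
    simpa only [habs, neg_neg] using hα (-c)

/-- A vector dominated by the weights, with zero sum, that attains `∑ i, d i * |x i - α|` is a
subgradient of `Nfun`. -/
theorem mem_subgrad_Nfun {n : ℕ} {d x v : Fin n → ℝ} {α : ℝ} (hv : ∀ i, |v i| ≤ d i)
    (hsum : ∑ i, v i = 0) (hx : ∀ i, v i * (x i - α) = d i * |x i - α|) :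
    v ∈ subgrad n (Nfun n d) x := by
  intro y
  have hle : Nfun n d x ≤ ∑ i, d i * |x i - α| := by
    refine csInf_le ⟨0, ?_⟩ ⟨α, rfl⟩
    rintro _ ⟨c, rfl⟩
    exact sum_nonneg fun i _ => mul_nonneg ((abs_nonneg _).trans (hv i)) (abs_nonneg _)
  refine le_csInf (Set.range_nonempty _) ?_
  rintro _ ⟨c, rfl⟩
  calc Nfun n d x + ∑ i, v i * (y i - x i)
      ≤ ∑ i, v i * (x i - α) + ∑ i, v i * (y i - x i) := by
        simpa only [hx] using add_le_add_left hle _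
    _ = ∑ i, v i * (y i - c) + (c - α) * ∑ i, v i := by
        rw [mul_sum, ← sum_add_distrib, ← sum_add_distrib]
        exact sum_congr rfl fun i _ => by ring
    _ = ∑ i, v i * (y i - c) := by rw [hsum, mul_zero, add_zero]
    _ ≤ ∑ i, d i * |y i - c| := sum_le_sum fun i _ =>
        (le_abs_self _).trans (abs_mul (v i) _ ▸ mul_le_mul_of_nonneg_right (hv i) (abs_nonneg _))

/-- the vector `v` built from a weighted median `α`
(`v_i = d_i sign(x_i - α)` off the median set, `v_i = (A/B) d_i` on it)
is a subgradient of `N` at `x`. -/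
theorem stmt8 (n : ℕ) (hn : 1 ≤ n) (w : Fin n → Fin n → ℝ)
    (hsymm : ∀ i j, w i j = w j i) (hnn : ∀ i j, 0 ≤ w i j)
    (hdiag : ∀ i, w i i = 0) (hd : ∀ i, 0 < dvec n w i)
    (x : Fin n → ℝ) (α : ℝ)
    (hα : ∀ c : ℝ, ∑ i, dvec n w i * |x i - α| ≤ ∑ i, dvec n w i * |x i - c|)
    (A B : ℝ)
    (hA : A = (∑ i ∈ univ.filter (fun i => x i < α), dvec n w i)
            - ∑ i ∈ univ.filter (fun i => α < x i), dvec n w i)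
    (hB : B = ∑ i ∈ univ.filter (fun i => x i = α), dvec n w i)
    (v : Fin n → ℝ)
    (hv : ∀ i, v i = if x i = α then (A / B) * dvec n w i
        else dvec n w i * (if α < x i then (1 : ℝ) else -1)) :
    v ∈ subgrad n (Nfun n (dvec n w)) x := by
  have hAB : |A| ≤ B := by
    have h₁ := sum_weight_right_le_of_isMin _ x α hα
    have h₂ := sum_weight_left_le_of_isMin _ x α hα
    rw [abs_le]
    constructor <;> linarith
  have hB₀ : 0 ≤ B := (abs_nonneg A).trans hAB
  refine mem_subgrad_Nfun (α := α) (fun i => ?_) ?_ fun i => ?_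
  · rw [hv]
    split_ifs
    · rw [abs_mul, abs_of_pos (hd i), abs_div, abs_of_nonneg hB₀]
      exact mul_le_of_le_one_left (hd i).le (div_le_one_of_le₀ hAB hB₀)
    · simp [abs_of_pos (hd i)]
    · simp [abs_of_pos (hd i)]
  · have hdiv : A / B * B = A :=
      div_mul_cancel_of_imp fun h => abs_nonpos_iff.1 (h ▸ hAB)
    have hsum : ∑ i, v i = A / B * B - A := by
      nth_rewrite 2 [hB]
      nth_rewrite 2 [hA]
      simp only [sum_filter, mul_sum, ← sum_sub_distrib]
      refine sum_congr rfl fun i _ => ?_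
      rw [hv]
      rcases lt_trichotomy (x i) α with h | h | h
      · simp [h, h.ne, h.not_gt]
      · simp [h]
      · simp [h, h.ne', h.not_gt]
    rw [hsum, hdiv, sub_self]
  · rw [hv]
    rcases lt_trichotomy (x i) α with h | h | h
    · rw [if_neg h.ne, if_neg h.not_gt, abs_of_neg (sub_neg.2 h)]
      ring
    · simp [h]
    · rw [if_neg h.ne', if_pos h, abs_of_pos (sub_pos.2 h), mul_one]
end
end

section
/- Assume vol(V) > 0. Let x ∈ ℝⁿ, x ≠ 0, set r = F(x), and let s ∈ ∂Q_r(x). Then r ≤ ‖s‖_1 = Σ_i |s_i|. Moreover, r = ‖s‖_1 if and only if x_i·s_i = ‖x‖_∞·|s_i| for every i (equivalently, x/‖x‖_∞ ∈ Sgn(s), i.e. x_i = ‖x‖_∞·sign(s_i) for every i with s_i ≠ 0). -/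
open Finset

noncomputable section

theorem Ifun_smul (n : ℕ) (w : Fin n → Fin n → ℝ) {t : ℝ} (ht : 0 < t) (x : Fin n → ℝ) :
    Ifun n w (t • x) = t * Ifun n w x := by
  simp only [Ifun, Finset.mul_sum, Pi.smul_apply, smul_eq_mul]
  refine Finset.sum_congr rfl fun i _ => Finset.sum_congr rfl fun j _ => ?_
  rw [← mul_sub, abs_mul, abs_of_pos ht]
  split_ifs <;> ring

theorem Nfun_smul (n : ℕ) (d : Fin n → ℝ) {t : ℝ} (ht : 0 < t) (x : Fin n → ℝ) :
    Nfun n d (t • x) = t * Nfun n d x := by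
  have key (c : ℝ) : ∑ i, d i * |t * x i - t * c| = t * ∑ i, d i * |x i - c| := by
    rw [Finset.mul_sum]
    refine Finset.sum_congr rfl fun i _ => ?_
    rw [← mul_sub, abs_mul, abs_of_pos ht]
    ring
  change ⨅ c : ℝ, ∑ i, d i * |t * x i - c| = t * ⨅ c : ℝ, ∑ i, d i * |x i - c|
  rw [Real.mul_iInf_of_nonneg ht.le, ← (Equiv.mulLeft₀ t ht.ne').iInf_comp]
  exact iInf_congr key

theorem Qfun_smul (n : ℕ) (w : Fin n → Fin n → ℝ) (r : ℝ) {t : ℝ} (ht : 0 < t)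
    (x : Fin n → ℝ) : Qfun n w r (t • x) = t * Qfun n w r x := by
  rw [Qfun, Qfun, Ifun_smul n w ht, Nfun_smul n _ ht]
  ring

theorem Nfun_le_sum_mul_norm (n : ℕ) (d : Fin n → ℝ) (hd : ∀ i, 0 ≤ d i) (x : Fin n → ℝ) :
    Nfun n d x ≤ (∑ i, d i) * ‖x‖ := by
  have hbdd : BddBelow (Set.range fun c : ℝ => ∑ i, d i * |x i - c|) :=
    ⟨0, by
      rintro _ ⟨c, rfl⟩
      exact Finset.sum_nonneg fun i _ => mul_nonneg (hd i) (abs_nonneg _)⟩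
  refine (csInf_le hbdd ⟨0, rfl⟩).trans ?_
  rw [Finset.sum_mul]
  refine Finset.sum_le_sum fun i _ => mul_le_mul_of_nonneg_left ?_ (hd i)
  simpa using norm_le_pi_norm x i

/-- Euler's identity for subgradients of a positively homogeneous function. -/
theorem sum_mul_eq_of_mem_subgrad {n : ℕ} {f : (Fin n → ℝ) → ℝ}
    (hf : ∀ t : ℝ, 0 < t → ∀ x, f (t • x) = t * f x) {x s : Fin n → ℝ}
    (hs : s ∈ subgrad n f x) : ∑ i, s i * x i = f x := by
  have key (t : ℝ) (ht : 0 < t) : f x + (t - 1) * ∑ i, s i * x i ≤ t * f x := by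
    rw [← hf t ht x, Finset.mul_sum]
    refine le_trans (le_of_eq ?_) (hs (t • x))
    congr 1
    refine Finset.sum_congr rfl fun i _ => ?_
    simp only [Pi.smul_apply, smul_eq_mul]
    ring
  linarith [key 2 (by norm_num), key (1 / 2) (by norm_num)]

theorem Qfun_Ffun_eq (n : ℕ) (w : Fin n → Fin n → ℝ) (hnn : ∀ i j, 0 ≤ w i j)
    (hvol : 0 < vol n w univ) {x : Fin n → ℝ} (hx : x ≠ 0) :
    Qfun n w (Ffun n w x) x = Ffun n w x * ‖x‖ := by
  have hN : Nfun n (dvec n w) x ≤ vol n w univ * ‖x‖ :=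
    Nfun_le_sum_mul_norm n _ (fun i => Finset.sum_nonneg fun j _ => hnn i j) x
  have hpos := mul_pos hvol (norm_pos_iff.mpr hx)
  have hden : 2 * vol n w univ * ‖x‖ - Nfun n (dvec n w) x ≠ 0 := by linarith
  have hF : Ffun n w x * (2 * vol n w univ * ‖x‖ - Nfun n (dvec n w) x) = Ifun n w x :=
    div_mul_cancel₀ _ hden
  rw [Qfun, div_eq_iff (by positivity)]
  linarith

/-- for `r = F(x)` and `s ∈ ∂Q_r(x)` one has `r ≤ ‖s‖₁`, with
equality iff `x_i s_i = ‖x‖_∞ |s_i|` for every `i` (i.e. `x/‖x‖_∞ ∈ Sgn(s)`). -/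
theorem stmt10 (n : ℕ) (hn : 1 ≤ n) (w : Fin n → Fin n → ℝ)
    (hsymm : ∀ i j, w i j = w j i) (hnn : ∀ i j, 0 ≤ w i j)
    (hdiag : ∀ i, w i i = 0) (hvol : 0 < vol n w univ)
    (x : Fin n → ℝ) (hx : x ≠ 0)
    (r : ℝ) (hr : r = Ffun n w x)
    (s : Fin n → ℝ) (hs : s ∈ subgrad n (Qfun n w r) x) :
    r ≤ (∑ i, |s i|) ∧
      (r = (∑ i, |s i|) ↔ ∀ i, x i * s i = ‖x‖ * |s i|) := by
  have hsum : ∑ i, x i * s i = r * ‖x‖ := by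
    subst hr
    rw [← Qfun_Ffun_eq n w hnn hvol hx,
      ← sum_mul_eq_of_mem_subgrad (fun t ht => Qfun_smul n w _ ht) hs]
    exact Finset.sum_congr rfl fun i _ => mul_comm _ _
  have hnorm : 0 < ‖x‖ := norm_pos_iff.mpr hx
  have hterm : ∀ i ∈ univ, x i * s i ≤ ‖x‖ * |s i| := fun i _ =>
    (le_abs_self _).trans <| by
      rw [abs_mul]
      exact mul_le_mul_of_nonneg_right (norm_le_pi_norm x i) (abs_nonneg _)
  constructor
  · refine le_of_mul_le_mul_right ?_ hnorm
    rw [← hsum, mul_comm, Finset.mul_sum]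
    exact Finset.sum_le_sum hterm
  · rw [← mul_left_inj' hnorm.ne', ← hsum, mul_comm (∑ i, |s i|), Finset.mul_sum,
      Finset.sum_eq_sum_iff_of_le hterm]
    simp
end
end

section
/- Let v ∈ ℝⁿ with |v_1| ≥ |v_2| ≥ … ≥ |v_n| and let 0 < r < ‖v‖_1. Set |v_{n+1}| = 0, A(m) = Σ_{j=1}^m (|v_j| − |v_{m+1}|) for 0 ≤ m ≤ n (so A(0) = 0), and m_1 = max{m ∈ {1,…,n} : A(m−1) < r}. Then the vector x* ∈ ℝⁿ defined by x*_i = sign(v_i)/m_1 for 1 ≤ i ≤ m_1 and x*_i = 0 for i > m_1 (note v_i ≠ 0 for i ≤ m_1) is a minimizer of x ↦ r·‖x‖_∞ − ⟨x, v⟩ over {x : ‖x‖_1 = 1}; that is, ‖x*‖_1 = 1 and r·‖x*‖_∞ − ⟨x*, v⟩ ≤ r·‖z‖_∞ − ⟨z, v⟩ for every z with ‖z‖_1 = 1. -/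
open Finset

noncomputable section

lemma Real.sign_mul_eq_abs (x : ℝ) : Real.sign x * x = |x| := by
  obtain h | rfl | h := lt_trichotomy x 0
  · rw [Real.sign_of_neg h, abs_of_neg h, neg_one_mul]
  · simp
  · rw [Real.sign_of_pos h, abs_of_pos h, one_mul]

/-- A sum over the first `m` of `n` indices, written over `Fin n`. -/
lemma sum_fin_ite_lt_eq_sum_range {n m : ℕ} (hm : m ≤ n) (f : ℕ → ℝ) :
    (∑ i : Fin n, if (i : ℕ) < m then f i else 0) = ∑ j ∈ Finset.range m, f j := by
  rw [Fin.sum_univ_eq_sum_range (fun k => if k < m then f k else 0) n, ← Finset.sum_filter]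
  congr 1
  ext k
  simp only [Finset.mem_filter, Finset.mem_range]
  omega

/-- Lagrangian bound: `l` is a multiplier for the constraint `‖z‖₁ = 1`. -/
lemma inner_le_of_threshold {n m : ℕ} {v z : Fin n → ℝ} {l : ℝ}
    (hz : ∑ i, |z i| = 1) (hlt : ∀ i : Fin n, (i : ℕ) < m → l ≤ |v i|)
    (hge : ∀ i : Fin n, m ≤ (i : ℕ) → |v i| ≤ l) :
    ∑ i, z i * v i ≤ l + ‖z‖ * ∑ i : Fin n, if (i : ℕ) < m then |v i| - l else 0 := by
  have hl : l = ∑ i, l * |z i| := by rw [← Finset.mul_sum, hz, mul_one]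
  conv_rhs => enter [1]; rw [hl]
  rw [Finset.mul_sum, ← Finset.sum_add_distrib]
  refine Finset.sum_le_sum fun i _ => ?_
  have h1 : z i * v i ≤ |z i| * |v i| := by rw [← abs_mul]; exact le_abs_self _
  have h2 : |z i| ≤ ‖z‖ := norm_le_pi_norm z i
  split_ifs with h
  · nlinarith [mul_le_mul_of_nonneg_right h2 (sub_nonneg.2 (hlt i h))]
  · nlinarith [mul_le_mul_of_nonneg_left (hge i (not_lt.1 h)) (abs_nonneg (z i))]

/-- Scenario 2, `p = 1`: with `|v|` sorted decreasingly, `0 < r < ‖v‖₁`,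
`A(m) = ∑_{j=1}^m (|v_j| - |v_{m+1}|)` and `m₁ = max{m ∈ {1,…,n} : A(m-1) < r}`,
the vector `x*` with `x*_i = sign(v_i)/m₁` for `i ≤ m₁` and `0` otherwise minimizes
`x ↦ r‖x‖_∞ - ⟨x, v⟩` over the unit `1`-sphere.  (`v` is `0`-indexed by `Fin n`, so the
paper's `v_k` is `v ⟨k-1, _⟩`, and `vabs m = |v_{m+1}|`, with `vabs n = 0`.) -/
theorem stmt13 (n : ℕ) (hn : 1 ≤ n) (v : Fin n → ℝ)
    (hsort : ∀ i j : Fin n, i ≤ j → |v j| ≤ |v i|)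
    (r : ℝ) (hr0 : 0 < r) (hr1 : r < ∑ i, |v i|)
    (vabs : ℕ → ℝ)
    (hvabs : ∀ k : ℕ, vabs k = if h : k < n then |v ⟨k, h⟩| else 0)
    (A : ℕ → ℝ) (hA : ∀ m : ℕ, A m = ∑ j ∈ Finset.range m, (vabs j - vabs m))
    (m1 : ℕ) (hm1mem : m1 ∈ Finset.Icc 1 n) (hm1lt : A (m1 - 1) < r)
    (hm1max : ∀ m ∈ Finset.Icc 1 n, A (m - 1) < r → m ≤ m1)
    (xstar : Fin n → ℝ)
    (hxstar : ∀ i : Fin n,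
      xstar i = if (i : ℕ) < m1 then Real.sign (v i) / (m1 : ℝ) else 0) :
    (∑ i, |xstar i|) = 1 ∧
    ∀ z : Fin n → ℝ, (∑ i, |z i|) = 1 →
      r * ‖xstar‖ - (∑ i, xstar i * v i) ≤ r * ‖z‖ - ∑ i, z i * v i := by
  obtain ⟨hm1, hmn⟩ := Finset.mem_Icc.1 hm1mem
  have hv : ∀ i : Fin n, vabs i = |v i| := fun i => by rw [hvabs, dif_pos i.2]
  have hA' : ∀ m, A m = ∑ j ∈ Finset.range m, vabs j - m * vabs m := fun m => by
    rw [hA, Finset.sum_sub_distrib]; simp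
  have hmpos : (0 : ℝ) < m1 := by exact_mod_cast hm1
  set S := ∑ j ∈ Finset.range m1, vabs j with hS
  have hprev : S - m1 * vabs (m1 - 1) < r := by
    obtain ⟨k, rfl⟩ : ∃ k, m1 = k + 1 := ⟨m1 - 1, by omega⟩
    rw [hA'] at hm1lt
    rw [hS, Finset.sum_range_succ]
    simp only [Nat.add_sub_cancel] at hm1lt ⊢
    push_cast
    linarith
  have hnext : r ≤ S - m1 * vabs m1 := by
    rcases hmn.lt_or_eq with h | h
    · by_contra! hlt
      have := hm1max (m1 + 1) (Finset.mem_Icc.2 ⟨by omega, h⟩)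
        (by rw [Nat.add_sub_cancel, hA']; exact hlt)
      omega
    · have hSn : S = ∑ i, |v i| := by
        rw [hS, h, ← Fin.sum_univ_eq_sum_range]
        exact Finset.sum_congr rfl fun i _ => hv i
      have h0 : vabs m1 = 0 := by rw [hvabs, dif_neg (by omega)]
      rw [h0, hSn]; linarith
  set l := (S - r) / m1 with hl
  have hml : m1 * l = S - r := by rw [hl]; field_simp
  have hlt : ∀ i : Fin n, (i : ℕ) < m1 → l < |v i| := fun i hi => by
    have h1 : |v ⟨m1 - 1, by omega⟩| ≤ |v i| := hsort _ _ (Fin.le_def.2 (by simp only; omega))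
    rw [← hv ⟨m1 - 1, by omega⟩] at h1
    refine lt_of_lt_of_le ?_ h1
    rw [hl, div_lt_iff₀ hmpos]
    linarith
  have hml' : vabs m1 ≤ l := by
    rw [hl, le_div_iff₀ hmpos]
    linarith
  have hge : ∀ i : Fin n, m1 ≤ (i : ℕ) → |v i| ≤ l := fun i hi => by
    have hm : m1 < n := hi.trans_lt i.2
    refine le_trans (hsort ⟨m1, hm⟩ i (Fin.le_def.2 hi)) ?_
    rwa [← hv ⟨m1, hm⟩]
  have hl0 : 0 ≤ l := by
    refine le_trans ?_ hml'
    rw [hvabs]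
    split_ifs
    · exact abs_nonneg _
    · exact le_rfl
  have hxabs : ∀ i, |xstar i| = if (i : ℕ) < m1 then 1 / (m1 : ℝ) else 0 := fun i => by
    rw [hxstar]
    split_ifs with h
    · have hvi : v i ≠ 0 := abs_pos.1 (hl0.trans_lt (hlt i h))
      rw [abs_div, abs_of_pos hmpos]
      rcases Real.sign_apply_eq_of_ne_zero _ hvi with h | h <;> simp [h]
    · exact abs_zero
  have hinner : ∑ i, xstar i * v i = S / m1 := by
    rw [hS, ← sum_fin_ite_lt_eq_sum_range hmn, Finset.sum_div]
    refine Finset.sum_congr rfl fun i _ => ?_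
    rw [hxstar, hv]
    split_ifs
    · rw [div_mul_eq_mul_div, Real.sign_mul_eq_abs]
    · simp
  have hnorm : ‖xstar‖ ≤ 1 / m1 := by
    refine (pi_norm_le_iff_of_nonneg (by positivity)).2 fun i => ?_
    rw [Real.norm_eq_abs, hxabs]
    split_ifs
    · exact le_rfl
    · positivity
  constructor
  · simp_rw [hxabs]
    rw [sum_fin_ite_lt_eq_sum_range hmn (fun _ => 1 / (m1 : ℝ))]
    simp [hmpos.ne']
  · intro z hz
    have hsum : (∑ i : Fin n, if (i : ℕ) < m1 then |v i| - l else 0) = r := by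
      simp_rw [← hv]
      rw [sum_fin_ite_lt_eq_sum_range hmn (fun k => vabs k - l), Finset.sum_sub_distrib]
      simp only [Finset.sum_const, Finset.card_range, nsmul_eq_mul]
      linarith
    have hz' := inner_le_of_threshold hz (fun i hi => (hlt i hi).le) hge
    rw [hsum] at hz'
    have hr := mul_le_mul_of_nonneg_left hnorm hr0.le
    have hl' : r * (1 / m1) - S / m1 = -l := by rw [hl]; ring
    rw [hinner]
    linarith
end
end

section
/- Let p ∈ (1, ∞), let v ∈ ℝⁿ with |v_1| ≥ |v_2| ≥ … ≥ |v_n|, and let 0 < r < ‖v‖_1. Set |v_{n+1}| = 0, A(m) = Σ_{j=1}^m (|v_j| − |v_{m+1}|), and m_0 = min{m ∈ {1,…,n} : A(m) > r} (this set is nonempty since A(n) = ‖v‖_1 > r, and Σ_{j=1}^{m_0}|v_j| − r > 0). Define z* ∈ ℝⁿ by z*_i = min{1, (m_0·|v_i| / (Σ_{j=1}^{m_0}|v_j| − r))^{1/(p−1)}}. Then x* = (sign(v_1)·z*_1, …, sign(v_n)·z*_n)/‖z*‖_p is a minimizer of x ↦ r·‖x‖_∞ − ⟨x, v⟩ over {x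 : ‖x‖_p = 1}, where sign(t) = 1 for t ≥ 0 and −1 for t < 0. -/
open Finset

noncomputable section

/-- The excess of a decreasing nonnegative sequence above the level
`c = (∑_{j < m₀} a_j - r) / m₀` has total mass `r`. -/
lemma sum_max_sub_level_eq {n m₀ : ℕ} {a : ℕ → ℝ} {r : ℝ} (ha : Antitone a) (hr : 0 < r)
    (hm₀ : m₀ ∈ Icc 1 n) (hgt : r < ∑ j ∈ range m₀, (a j - a m₀))
    (hmin : ∀ m ∈ Icc 1 n, r < ∑ j ∈ range m, (a j - a m) → m₀ ≤ m) :
    ∑ j ∈ range n, max (a j - ((∑ j ∈ range m₀, a j) - r) / m₀) 0 = r := by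
  obtain ⟨h1, hn⟩ := mem_Icc.1 hm₀
  obtain ⟨k, rfl⟩ : ∃ k, m₀ = k + 1 := ⟨m₀ - 1, by omega⟩
  have hpos : (0 : ℝ) < ((k + 1 : ℕ) : ℝ) := by positivity
  set S := (∑ j ∈ range (k + 1), a j) - r with hS
  have hupper : a (k + 1) ≤ S / (k + 1 : ℕ) := by
    rw [le_div_iff₀ hpos]
    simp only [sum_sub_distrib, sum_const, card_range, nsmul_eq_mul] at hgt
    linarith
  have hlower : S / (k + 1 : ℕ) ≤ a k := by
    rw [div_le_iff₀ hpos]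
    have hk : ∑ j ∈ range k, (a j - a k) ≤ r := by
      rcases Nat.eq_zero_or_pos k with rfl | hk
      · simpa using hr.le
      · by_contra! h
        have := hmin k (mem_Icc.2 ⟨hk, by omega⟩) h
        omega
    simp only [sum_sub_distrib, sum_const, card_range, nsmul_eq_mul] at hk
    rw [hS, sum_range_succ]
    push_cast
    linarith
  have hsub : range (k + 1) ⊆ range n := range_subset_range.2 hn
  rw [← sum_subset hsub]
  · have : ∀ j ∈ range (k + 1), max (a j - S / (k + 1 : ℕ)) 0 = a j - S / (k + 1 : ℕ) := by
      intro j hj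
      have := ha (show j ≤ k by have := mem_range.1 hj; omega)
      exact max_eq_left (by linarith)
    rw [sum_congr rfl this, sum_sub_distrib, sum_const, card_range, nsmul_eq_mul,
      mul_div_cancel₀ _ hpos.ne', hS]
    ring
  · intro j _ hj
    have := ha (show k + 1 ≤ j by simpa using hj)
    exact max_eq_right (by linarith)

/-- Thresholded powers `z = min(1, (|t|/c)^{1/(p-1)})` satisfy `c z^{p-1} = min(|t|, c)`. -/
lemma mul_min_one_rpow_eq {p c t : ℝ} (hp : 1 < p) (hc : 0 < c) (ht : 0 ≤ t) :
    c * (min 1 ((t / c) ^ (1 / (p - 1)))) ^ (p - 1) = min t c := by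
  have hp' : 0 < p - 1 := by linarith
  have htc : 0 ≤ t / c := by positivity
  rcases le_total c t with h | h
  · rw [min_eq_left (Real.one_le_rpow ((one_le_div hc).2 h) (by positivity)), Real.one_rpow,
      min_eq_right h, mul_one]
  · rw [min_eq_right (Real.rpow_le_one htc ((div_le_one hc).2 h) (by positivity)),
      ← Real.rpow_mul htc, one_div, inv_mul_cancel₀ hp'.ne', Real.rpow_one, min_eq_left h,
      mul_div_cancel₀ _ hc.ne']

/-- Scenario 1, `1 < p < ∞`: with `|v|` sorted decreasingly,
`0 < r < ‖v‖₁`, `A(m) = ∑_{j=1}^m (|v_j| - |v_{m+1}|)`,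
`m₀ = min{m ∈ {1,…,n} : A(m) > r}`,
`z*_i = min{1, (m₀|v_i|/(∑_{j=1}^{m₀}|v_j| - r))^{1/(p-1)}}` and
`x* = sign(v) z*/‖z*‖_p` (with `sign t = 1` for `t ≥ 0`, `-1` for `t < 0`),
`x*` minimizes `x ↦ r‖x‖_∞ - ⟨x, v⟩` over the unit `p`-sphere.
(`v` is `0`-indexed by `Fin n`; `vabs m = |v_{m+1}|`, with `vabs n = 0`.) -/
theorem stmt14 (n : ℕ) (hn : 1 ≤ n) (p : ℝ) (hp1 : 1 < p) (v : Fin n → ℝ)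
    (hsort : ∀ i j : Fin n, i ≤ j → |v j| ≤ |v i|)
    (r : ℝ) (hr0 : 0 < r) (hr1 : r < ∑ i, |v i|)
    (vabs : ℕ → ℝ)
    (hvabs : ∀ k : ℕ, vabs k = if h : k < n then |v ⟨k, h⟩| else 0)
    (A : ℕ → ℝ) (hA : ∀ m : ℕ, A m = ∑ j ∈ Finset.range m, (vabs j - vabs m))
    (m0 : ℕ) (hm0mem : m0 ∈ Finset.Icc 1 n) (hm0gt : r < A m0)
    (hm0min : ∀ m ∈ Finset.Icc 1 n, r < A m → m0 ≤ m)
    (zstar : Fin n → ℝ)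
    (hzstar : ∀ i : Fin n, zstar i =
      min 1 (((m0 : ℝ) * |v i| / ((∑ j ∈ Finset.range m0, vabs j) - r)) ^ (1 / (p - 1))))
    (xstar : Fin n → ℝ)
    (hxstar : ∀ i : Fin n,
      xstar i = (if 0 ≤ v i then (1 : ℝ) else -1) * zstar i / pnorm n p zstar) :
    pnorm n p xstar = 1 ∧
    ∀ z : Fin n → ℝ, pnorm n p z = 1 →
      r * ‖xstar‖ - (∑ i, xstar i * v i) ≤ r * ‖z‖ - ∑ i, z i * v i := by
  obtain ⟨hm1, -⟩ := mem_Icc.1 hm0mem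
  have hvabs_nonneg : ∀ k, 0 ≤ vabs k := by
    intro k
    rw [hvabs]
    split_ifs <;> positivity
  have hvabs_fin : ∀ i : Fin n, vabs i = |v i| := fun i => by simp [hvabs]
  have hanti : Antitone vabs := by
    intro i j hij
    by_cases hj : j < n
    · have hi : i < n := by omega
      rw [hvabs j, hvabs i, dif_pos hj, dif_pos hi]
      exact hsort _ _ hij
    · rw [hvabs j, dif_neg hj]
      exact hvabs_nonneg i
  have hmpos : (0 : ℝ) < m0 := by exact_mod_cast hm1
  set S := (∑ j ∈ range m0, vabs j) - r with hS
  have hSpos : 0 < S := by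
    rw [hA] at hm0gt
    simp only [sum_sub_distrib, sum_const, card_range, nsmul_eq_mul] at hm0gt
    have := mul_nonneg hmpos.le (hvabs_nonneg m0)
    linarith
  set c := S / m0 with hc
  have hcpos : 0 < c := by positivity
  have hexcess : ∑ i, max (|v i| - c) 0 = r := by
    have h := sum_max_sub_level_eq hanti hr0 hm0mem (by rwa [← hA])
      (fun m hm h => hm0min m hm (by rwa [hA]))
    rw [sum_range] at h
    simpa only [hvabs_fin] using h
  have hz : ∀ i, zstar i = min 1 ((|v i| / c) ^ (1 / (p - 1))) := by
    intro i
    rw [hzstar, hc, div_div_eq_mul_div, mul_comm (m0 : ℝ)]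
  have hznn : ∀ i, 0 ≤ zstar i := fun i => by rw [hz]; positivity
  have hzle : ∀ i, zstar i ≤ 1 := fun i => by rw [hz]; exact min_le_left _ _
  have hzpow : ∀ i, c * zstar i ^ (p - 1) = min |v i| c := fun i => by
    rw [hz]; exact mul_min_one_rpow_eq hp1 hcpos (abs_nonneg _)
  have hsplit : ∀ i, |v i| = c * zstar i ^ (p - 1) + max (|v i| - c) 0 := by
    intro i
    rw [hzpow]
    rcases le_total |v i| c with h | h
    · rw [min_eq_left h, max_eq_right (by linarith), add_zero]
    · rw [min_eq_right h, max_eq_left (by linarith)]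
      ring
  have hzone : ∀ i, c ≤ |v i| → zstar i = 1 := by
    intro i h
    rw [hz, min_eq_left (Real.one_le_rpow ((one_le_div hcpos).2 h)
      (one_div_nonneg.2 (by linarith)))]
  have hexz : ∀ i, zstar i * max (|v i| - c) 0 = max (|v i| - c) 0 := by
    intro i
    rcases le_total |v i| c with h | h
    · rw [max_eq_right (by linarith), mul_zero]
    · rw [hzone i h, one_mul]
  obtain ⟨i₀, hi₀⟩ : ∃ i, zstar i = 1 := by
    by_contra! h
    have : ∑ i, max (|v i| - c) 0 = 0 := sum_eq_zero fun i _ =>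
      max_eq_right (by
        have : ¬ c ≤ |v i| := fun hi => h i (hzone i hi)
        linarith)
    linarith
  set T := ∑ i, zstar i ^ p with hT
  have hTpos : 0 < T := by
    refine sum_pos' (fun i _ => Real.rpow_nonneg (hznn i) _) ⟨i₀, mem_univ _, ?_⟩
    rw [hi₀, Real.one_rpow]
    exact one_pos
  have hN : pnorm n p zstar = T ^ (1 / p) := by
    simp only [pnorm, abs_of_nonneg (hznn _), hT]
  set N := T ^ (1 / p) with hNdef
  have hNpos : 0 < N := Real.rpow_pos_of_pos hTpos _
  have hNp : N ^ p = T := by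
    rw [hNdef, ← Real.rpow_mul hTpos.le, one_div, inv_mul_cancel₀ (by linarith), Real.rpow_one]
  have habs : ∀ i, |xstar i| = zstar i / N := by
    intro i
    rw [hxstar, hN, abs_div, abs_mul, abs_of_nonneg (hznn i), abs_of_pos hNpos]
    split_ifs <;> simp
  have hxnorm : ‖xstar‖ = 1 / N := by
    apply le_antisymm
    · refine (pi_norm_le_iff_of_nonneg (by positivity)).2 fun i => ?_
      rw [Real.norm_eq_abs, habs]
      gcongr
      exact hzle i
    · have := norm_le_pi_norm xstar i₀
      rwa [Real.norm_eq_abs, habs, hi₀] at this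
  have hxv : ∀ i, xstar i * v i = (c * zstar i ^ p + max (|v i| - c) 0) / N := by
    intro i
    have h1 : xstar i * v i = zstar i * |v i| / N := by
      rw [hxstar, hN]
      split_ifs with h
      · rw [abs_of_nonneg h]; ring
      · rw [abs_of_neg (not_le.1 h)]; ring
    have h2 : zstar i * zstar i ^ (p - 1) = zstar i ^ p := by
      rw [← Real.rpow_one_add' (hznn i) (by linarith)]
      congr 1
      ring
    rw [h1]
    congr 1
    conv_lhs => rw [hsplit i]
    rw [mul_add, hexz, ← h2]
    ring
  have hpq : p.HolderConjugate (p / (p - 1)) := Real.HolderConjugate.conjExponent hp1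
  have hvalue : r * ‖xstar‖ - ∑ i, xstar i * v i = -(c * T ^ (1 / (p / (p - 1)))) := by
    have hTN : T = T ^ (1 / (p / (p - 1))) * N := by
      rw [hNdef, ← Real.rpow_add hTpos, one_div, one_div, add_comm, hpq.inv_add_inv_eq_one,
        Real.rpow_one]
    simp only [hxv]
    rw [hxnorm, ← sum_div, sum_add_distrib, ← mul_sum, hexcess, ← hT]
    generalize T ^ (1 / (p / (p - 1))) = K at hTN ⊢
    field_simp
    linear_combination (-c) * hTN
  refine ⟨?_, fun x hx => ?_⟩
  · have : ∑ i, |xstar i| ^ p = 1 := by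
      simp only [habs, Real.div_rpow (hznn _) hNpos.le, hNp]
      rw [← sum_div, ← hT, div_self hTpos.ne']
    rw [pnorm, this, Real.one_rpow]
  · have holder : ∑ i, |x i| * zstar i ^ (p - 1) ≤ T ^ (1 / (p / (p - 1))) := by
      have h := Real.inner_le_Lp_mul_Lq univ (fun i => |x i|) (fun i => zstar i ^ (p - 1)) hpq
      have hq : ∀ i, |zstar i ^ (p - 1)| ^ (p / (p - 1)) = zstar i ^ p := by
        intro i
        rw [abs_of_nonneg (Real.rpow_nonneg (hznn i) _), ← Real.rpow_mul (hznn i),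
          mul_div_cancel₀ _ (by linarith)]
      simp only [abs_abs, hq] at h
      rw [pnorm] at hx
      rwa [hx, one_mul] at h
    have hterm : ∀ i, x i * v i ≤
        c * (|x i| * zstar i ^ (p - 1)) + ‖x‖ * max (|v i| - c) 0 := by
      intro i
      have h1 : x i * v i ≤ |x i| * |v i| := by
        rw [← abs_mul]; exact le_abs_self _
      have h2 : |x i| * max (|v i| - c) 0 ≤ ‖x‖ * max (|v i| - c) 0 :=
        mul_le_mul_of_nonneg_right (norm_le_pi_norm x i) (le_max_right _ _)
      have h3 : |x i| * |v i| =
          c * (|x i| * zstar i ^ (p - 1)) + |x i| * max (|v i| - c) 0 := by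
        linear_combination |x i| * hsplit i
      linarith
    have hsum := sum_le_sum fun i (_ : i ∈ univ) => hterm i
    rw [sum_add_distrib, ← mul_sum, ← mul_sum, hexcess] at hsum
    have := mul_le_mul_of_nonneg_left holder hcpos.le
    rw [hvalue]
    linarith
end
end

section
/- Let p ∈ [1, ∞), let v ∈ ℝⁿ with |v_1| ≥ |v_2| ≥ … ≥ |v_n|, and let 0 < r < ‖v‖_1. Set |v_{n+1}| = 0, A(m) = Σ_{j=1}^m (|v_j| − |v_{m+1}|), and m_0 = min{m ∈ {1,…,n} : A(m) > r}. Then there exists a minimizer x* of x ↦ r·‖x‖_∞ − ⟨x, v⟩ over {x : ‖x‖_p = 1} which satisfies ⟨x*, v⟩ ≥ ‖x*‖_∞ · Σ_{i=1}^{m_0} |v_i|. -/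
open Finset

noncomputable section

lemma pnorm_eq_one_iff {n : ℕ} {p : ℝ} (hp : 1 ≤ p) (x : Fin n → ℝ) :
    pnorm n p x = 1 ↔ ∑ i, |x i| ^ p = 1 := by
  have h0 : 0 ≤ ∑ i, |x i| ^ p := Finset.sum_nonneg fun i _ => Real.rpow_nonneg (abs_nonneg _) _
  have hp' : 1 / p ≠ 0 := by positivity
  unfold pnorm
  constructor
  · intro h
    exact (Real.rpow_left_inj h0 zero_le_one hp').1 (h.trans (Real.one_rpow _).symm)
  · intro h
    rw [h, Real.one_rpow]

/-- The unit `p`-sphere is compact. -/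
lemma isCompact_pnorm_sphere (n : ℕ) {p : ℝ} (hp : 1 ≤ p) :
    IsCompact {x : Fin n → ℝ | pnorm n p x = 1} := by
  have hp0 : 0 < p := by linarith
  simp only [pnorm_eq_one_iff hp]
  refine IsCompact.of_isClosed_subset (isCompact_closedBall (0 : Fin n → ℝ) 1) ?_ ?_
  · refine isClosed_eq (continuous_finsetSum _ fun i _ => ?_) continuous_const
    exact (continuous_apply i).abs.rpow_const fun _ => Or.inr hp0.le
  · intro x hx
    rw [mem_closedBall_zero_iff, pi_norm_le_iff_of_nonneg zero_le_one]
    intro i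
    have hsum : ∑ i, |x i| ^ p = 1 := hx
    have h : |x i| ^ p ≤ 1 := by
      rw [← hsum]
      exact Finset.single_le_sum (f := fun i => |x i| ^ p)
        (fun j _ => Real.rpow_nonneg (abs_nonneg _) _) (mem_univ i)
    by_contra hlt
    exact absurd h (not_le.2 (Real.one_lt_rpow (not_le.1 hlt) hp0))

/-- Rescaling a nonzero vector to the unit `p`-sphere. -/
lemma pnorm_rescale {n : ℕ} {p : ℝ} (hp : 1 ≤ p) (x : Fin n → ℝ)
    (hx : 0 < ∑ i, |x i| ^ p) :
    pnorm n p (fun i => (∑ i, |x i| ^ p) ^ (-(1 / p)) * x i) = 1 := by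
  have hp0 : p ≠ 0 := by positivity
  rw [pnorm_eq_one_iff hp]
  set T := ∑ i, |x i| ^ p with hT
  have h : ∀ i, |T ^ (-(1 / p)) * x i| ^ p = T⁻¹ * |x i| ^ p := fun i => by
    rw [abs_mul, abs_of_pos (Real.rpow_pos_of_pos hx _),
      Real.mul_rpow (Real.rpow_nonneg hx.le _) (abs_nonneg _), ← Real.rpow_mul hx.le]
    have : -(1 / p) * p = -1 := by field_simp
    rw [this, Real.rpow_neg_one]
  simp only [h, ← Finset.mul_sum, ← hT]
  exact inv_mul_cancel₀ hx.ne'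

lemma sum_rpow_pos {n : ℕ} (p : ℝ) {x : Fin n → ℝ} (hx : x ≠ 0) :
    0 < ∑ i, |x i| ^ p := by
  obtain ⟨i, hi⟩ := Function.ne_iff.1 hx
  exact Finset.sum_pos' (fun i _ => Real.rpow_nonneg (abs_nonneg _) _)
    ⟨i, mem_univ i, Real.rpow_pos_of_pos (abs_pos.2 hi) _⟩

/-- Sorting the absolute values of `x` does not decrease its pairing with a sorted vector. -/
lemma exists_antitone_rearrangement {n : ℕ} (u x : Fin n → ℝ) (hu : Antitone u) :
    ∃ σ : Equiv.Perm (Fin n), Antitone (fun i => |x (σ i)|) ∧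
      ∑ i, |x i| * u i ≤ ∑ i, |x (σ i)| * u i := by
  have hmono := Tuple.monotone_sort (fun i => -|x i|)
  set σ := Tuple.sort (fun i => -|x i|) with hσ
  have hanti : Antitone (fun i => |x (σ i)|) := fun i j hij => by
    have := hmono hij
    simp only [Function.comp] at this
    linarith
  refine ⟨σ, hanti, ?_⟩
  have h := (hanti.monovary hu).sum_comp_perm_mul_le_sum_mul (σ := σ⁻¹)
  simpa using h

/-- `y` with its entries on `S` replaced by their mean. -/
def flatten {n : ℕ} (S : Finset (Fin n)) (y : Fin n → ℝ) (i : Fin n) : ℝ :=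
  if i ∈ S then (∑ j ∈ S, y j) / #S else y i

lemma sum_flatten_rpow_le {n : ℕ} {p : ℝ} (hp : 1 ≤ p) {S : Finset (Fin n)}
    (hS : S.Nonempty) {y : Fin n → ℝ} (hy : ∀ i, 0 ≤ y i) :
    ∑ i, flatten S y i ^ p ≤ ∑ i, y i ^ p := by
  have hc : (0 : ℝ) < #S := by exact_mod_cast hS.card_pos
  rw [← Finset.sum_add_sum_compl S, ← Finset.sum_add_sum_compl S (fun i => y i ^ p)]
  have h1 : ∑ i ∈ S, flatten S y i ^ p = #S * ((∑ j ∈ S, y j) / #S) ^ p := by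
    rw [Finset.sum_congr rfl (g := fun _ => ((∑ j ∈ S, y j) / #S) ^ p)
      (fun i hi => by simp [flatten, hi])]
    simp
  have h2 : ∑ i ∈ Sᶜ, flatten S y i ^ p = ∑ i ∈ Sᶜ, y i ^ p :=
    Finset.sum_congr rfl fun i hi => by simp [flatten, Finset.mem_compl.1 hi]
  have h3 := Real.rpow_arith_mean_le_arith_mean_rpow S (fun _ => (#S : ℝ)⁻¹) y
    (fun _ _ => by positivity) (by simp [hc.ne']) (fun i _ => hy i) hp
  simp only [← Finset.mul_sum] at h3
  rw [h1, h2]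
  refine add_le_add ?_ le_rfl
  rw [div_eq_inv_mul]
  calc _ ≤ (#S : ℝ) * ((#S : ℝ)⁻¹ * ∑ i ∈ S, y i ^ p) := by gcongr
    _ = _ := by field_simp

/-- Flattening on `S` costs at most `r` times the decrease of the maximum. -/
lemma sum_mul_le_sum_flatten_mul {n : ℕ} {S : Finset (Fin n)} (hS : S.Nonempty)
    {u y : Fin n → ℝ} {b r M : ℝ} (hb : ∀ i ∈ S, b ≤ u i) (hr : ∑ i ∈ S, (u i - b) ≤ r)
    (hM : ∀ i, y i ≤ M) :
    ∑ i, y i * u i - r * M ≤ ∑ i, flatten S y i * u i - r * ((∑ j ∈ S, y j) / #S) := by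
  have hc : (0 : ℝ) < #S := by exact_mod_cast hS.card_pos
  rw [← Finset.sum_add_sum_compl S, ← Finset.sum_add_sum_compl S (fun i => flatten S y i * u i)]
  have h2 : ∑ i ∈ Sᶜ, flatten S y i * u i = ∑ i ∈ Sᶜ, y i * u i :=
    Finset.sum_congr rfl fun i hi => by simp [flatten, Finset.mem_compl.1 hi]
  have h1 : ∑ i ∈ S, flatten S y i * u i = ∑ i ∈ S, (∑ j ∈ S, y j) / #S * u i :=
    Finset.sum_congr rfl fun i hi => by simp [flatten, hi]
  rw [h1, h2]
  set a := (∑ j ∈ S, y j) / #S with ha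
  have hsum : ∑ i ∈ S, (y i - a) = 0 := by
    rw [Finset.sum_sub_distrib, Finset.sum_const, nsmul_eq_mul, ha]
    field_simp
    simp
  have haM : a ≤ M := by
    rw [ha, div_le_iff₀ hc, mul_comm, ← nsmul_eq_mul]
    exact Finset.sum_le_card_nsmul _ _ _ fun i _ => hM i
  have key : ∑ i ∈ S, y i * u i - ∑ i ∈ S, a * u i = ∑ i ∈ S, (u i - b) * (y i - a) := by
    have : ∑ i ∈ S, (u i - b) * (y i - a)
        = ∑ i ∈ S, y i * u i - ∑ i ∈ S, a * u i - b * ∑ i ∈ S, (y i - a) := by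
      rw [Finset.mul_sum, ← Finset.sum_sub_distrib, ← Finset.sum_sub_distrib]
      exact Finset.sum_congr rfl fun i _ => by ring
    rw [this, hsum]
    ring
  have hle : ∑ i ∈ S, (u i - b) * (y i - a) ≤ r * (M - a) := by
    calc _ ≤ ∑ i ∈ S, (u i - b) * (M - a) := Finset.sum_le_sum fun i hi =>
          mul_le_mul_of_nonneg_left (by linarith [hM i]) (by linarith [hb i hi])
      _ = (∑ i ∈ S, (u i - b)) * (M - a) := by rw [Finset.sum_mul]
      _ ≤ _ := mul_le_mul_of_nonneg_right hr (by linarith)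
  linarith

lemma sum_filter_lt_eq_sum_range {n m : ℕ} (hm : m ≤ n) (g : ℕ → ℝ) :
    ∑ i : Fin n with i.val < m, g i = ∑ j ∈ Finset.range m, g j := by
  refine Finset.sum_nbij (fun i => i.val) (by simp) (fun i _ j _ h => Fin.ext h) ?_ (by simp)
  intro j hj
  have hj' : j < m := by simpa using hj
  exact ⟨⟨j, hj'.trans_le hm⟩, by simpa using hj', rfl⟩

/-- A minimizer that is flat on `S`, for `v` sorted by absolute value and `S` an initial segment. -/
lemma exists_minimizer_flat {n : ℕ} {p : ℝ} (hp : 1 ≤ p) {v : Fin n → ℝ}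
    (hsort : Antitone fun i => |v i|) {r : ℝ} (hr0 : 0 < r) (hr1 : r < ∑ i, |v i|)
    {S : Finset (Fin n)} (hS : S.Nonempty) (hSlow : ∀ i ∈ S, ∀ j ∉ S, i ≤ j) {b : ℝ}
    (hb : ∀ i ∈ S, b ≤ |v i|) (hbr : ∑ i ∈ S, (|v i| - b) ≤ r) :
    ∃ x : Fin n → ℝ, pnorm n p x = 1 ∧
      (∀ z : Fin n → ℝ, pnorm n p z = 1 →
        r * ‖x‖ - (∑ i, x i * v i) ≤ r * ‖z‖ - ∑ i, z i * v i) ∧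
      ‖x‖ * (∑ i ∈ S, |v i|) ≤ ∑ i, x i * v i := by
  have hp0 : 0 < p := by linarith
  have hc : (0 : ℝ) < #S := by exact_mod_cast hS.card_pos
  obtain ⟨s, hs1, hsv⟩ : ∃ s : Fin n → ℝ, (∀ i, |s i| = 1) ∧ ∀ i, s i * v i = |v i| := by
    refine ⟨fun i => if 0 ≤ v i then 1 else -1, fun i => ?_, fun i => ?_⟩
    · dsimp only; split_ifs <;> simp
    · dsimp only
      split_ifs with h
      · rw [abs_of_nonneg h, one_mul]
      · rw [abs_of_neg (not_le.1 h)]; ring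
  have hsnorm : ‖s‖ ≤ 1 := (pi_norm_le_iff_of_nonneg zero_le_one).2 fun i => (hs1 i).le
  have hs0 : s ≠ 0 := by
    rintro rfl
    obtain ⟨i, -⟩ := hS
    simpa using hs1 i
  have hsphere := pnorm_rescale hp s (sum_rpow_pos p hs0)
  obtain ⟨x, hx, hxmin⟩ := (isCompact_pnorm_sphere n hp).exists_isMinOn ⟨_, hsphere⟩
    (f := fun z : Fin n → ℝ => r * ‖z‖ - ∑ i, z i * v i) (by fun_prop)
  have hmin : ∀ z : Fin n → ℝ, pnorm n p z = 1 →
      r * ‖x‖ - (∑ i, x i * v i) ≤ r * ‖z‖ - ∑ i, z i * v i := fun z hz => hxmin hz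
  have hscale : ∀ (c : ℝ), 0 < c → ∀ z : Fin n → ℝ,
      r * ‖fun i => c * z i‖ - ∑ i, c * z i * v i = c * (r * ‖z‖ - ∑ i, z i * v i) := by
    intro c hc z
    have : (fun i => c * z i) = c • z := rfl
    rw [this, norm_smul, Real.norm_of_nonneg hc.le, mul_sub, Finset.mul_sum]
    simp only [mul_assoc]
    ring
  have hneg : r * ‖x‖ - ∑ i, x i * v i < 0 := by
    have hcpos := Real.rpow_pos_of_pos (sum_rpow_pos p hs0) (-(1 / p))
    refine (hmin _ hsphere).trans_lt ?_
    rw [hscale _ hcpos]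
    refine mul_neg_of_pos_of_neg hcpos ?_
    simp only [hsv]
    nlinarith
  obtain ⟨σ, hanti, hσ⟩ := exists_antitone_rearrangement (fun i => |v i|) x hsort
  set y : Fin n → ℝ := fun i => |x (σ i)| with hy
  have hy0 : ∀ i, 0 ≤ y i := fun i => abs_nonneg _
  have hyM : ∀ i, y i ≤ ‖x‖ := fun i => norm_le_pi_norm x (σ i)
  have hyp : ∑ i, y i ^ p = 1 := by
    rw [← (pnorm_eq_one_iff hp x).1 hx]
    exact Equiv.sum_comp σ fun i => |x i| ^ p
  set a := (∑ j ∈ S, y j) / #S with ha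
  have ha0 : 0 ≤ a := div_nonneg (Finset.sum_nonneg fun i _ => hy0 i) hc.le
  set w := flatten S y with hw
  have hwS : ∀ i ∈ S, w i = a := fun i hi => by simp [hw, flatten, hi, ha]
  have hw0 : ∀ i, 0 ≤ w i := fun i => by
    by_cases hi : i ∈ S
    · rw [hwS i hi]; exact ha0
    · simpa [hw, flatten, hi] using hy0 i
  have hwa : ∀ i, w i ≤ a := fun i => by
    by_cases hi : i ∈ S
    · exact (hwS i hi).le
    · have : w i = y i := by simp [hw, flatten, hi]
      rw [this, ha, le_div_iff₀ hc, mul_comm, ← nsmul_eq_mul]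
      exact Finset.card_nsmul_le_sum _ _ _ fun j hj => hanti (hSlow j hj i hi)
  have hwp : ∑ i, w i ^ p ≤ 1 := hyp ▸ sum_flatten_rpow_le hp hS hy0
  have hgain := sum_mul_le_sum_flatten_mul hS hb hbr hyM
  have hxy : ∑ i, x i * v i ≤ ∑ i, y i * |v i| :=
    (Finset.sum_le_sum fun i _ => (le_abs_self _).trans (abs_mul _ _).le).trans hσ
  set q : Fin n → ℝ := fun i => s i * w i with hq
  have hqabs : ∀ i, |q i| = w i := fun i => by
    rw [hq, abs_mul, hs1, one_mul, abs_of_nonneg (hw0 i)]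
  have hqv : ∀ i, q i * v i = w i * |v i| := fun i => by
    rw [← hsv i, hq]; ring
  have hqnorm : ‖q‖ ≤ a := (pi_norm_le_iff_of_nonneg ha0).2 fun i => by
    rw [Real.norm_eq_abs, hqabs]; exact hwa i
  have hqval : r * ‖q‖ - ∑ i, q i * v i ≤ r * ‖x‖ - ∑ i, x i * v i := by
    simp only [hqv]
    have := mul_le_mul_of_nonneg_left hqnorm hr0.le
    linarith
  have hq0 : q ≠ 0 := by
    intro h
    rw [h] at hqval
    simp at hqval
    linarith
  have hT := sum_rpow_pos p hq0
  have hT1 : ∑ i, |q i| ^ p ≤ 1 := by simpa only [hqabs] using hwp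
  have hcpos := Real.rpow_pos_of_pos hT (-(1 / p))
  have hc1 : 1 ≤ (∑ i, |q i| ^ p) ^ (-(1 / p)) :=
    Real.one_le_rpow_of_pos_of_le_one_of_nonpos hT hT1 (by
      have : 0 < 1 / p := by positivity
      linarith)
  refine ⟨_, pnorm_rescale hp q hT, fun z hz => ?_, ?_⟩
  · rw [hscale _ hcpos]
    have := hmin z hz
    nlinarith
  · generalize (∑ i, |q i| ^ p) ^ (-(1 / p)) = c at hcpos
    have hcq : ‖fun i => c * q i‖ = c * ‖q‖ := by
      have : (fun i => c * q i) = c • q := rfl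
      rw [this, norm_smul, Real.norm_of_nonneg hcpos.le]
    simp only [hcq, mul_assoc, ← Finset.mul_sum, hqv]
    refine mul_le_mul_of_nonneg_left ?_ hcpos.le
    calc ‖q‖ * ∑ i ∈ S, |v i| ≤ a * ∑ i ∈ S, |v i| :=
          mul_le_mul_of_nonneg_right hqnorm (Finset.sum_nonneg fun i _ => abs_nonneg _)
      _ = ∑ i ∈ S, w i * |v i| := by
          rw [Finset.mul_sum]
          exact Finset.sum_congr rfl fun i hi => by rw [hwS i hi]
      _ ≤ ∑ i, w i * |v i| := Finset.sum_le_univ_sum_of_nonneg fun i =>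
          mul_nonneg (hw0 i) (abs_nonneg _)

/-- for `p ∈ [1, ∞)`, sorted `|v|`, `0 < r < ‖v‖₁` and
`m₀ = min{m : A(m) > r}`, some minimizer `x*` of `x ↦ r‖x‖_∞ - ⟨x, v⟩` over the unit
`p`-sphere satisfies `⟨x*, v⟩ ≥ ‖x*‖_∞ ∑_{i=1}^{m₀} |v_i|`.
(`v` is `0`-indexed by `Fin n`; `vabs m = |v_{m+1}|`, with `vabs n = 0`.) -/
theorem stmt16 (n : ℕ) (hn : 1 ≤ n) (p : ℝ) (hp : 1 ≤ p) (v : Fin n → ℝ)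
    (hsort : ∀ i j : Fin n, i ≤ j → |v j| ≤ |v i|)
    (r : ℝ) (hr0 : 0 < r) (hr1 : r < ∑ i, |v i|)
    (vabs : ℕ → ℝ)
    (hvabs : ∀ k : ℕ, vabs k = if h : k < n then |v ⟨k, h⟩| else 0)
    (A : ℕ → ℝ) (hA : ∀ m : ℕ, A m = ∑ j ∈ Finset.range m, (vabs j - vabs m))
    (m0 : ℕ) (hm0mem : m0 ∈ Finset.Icc 1 n) (hm0gt : r < A m0)
    (hm0min : ∀ m ∈ Finset.Icc 1 n, r < A m → m0 ≤ m) :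
    ∃ xstar : Fin n → ℝ, pnorm n p xstar = 1 ∧
      (∀ z : Fin n → ℝ, pnorm n p z = 1 →
        r * ‖xstar‖ - (∑ i, xstar i * v i) ≤ r * ‖z‖ - ∑ i, z i * v i) ∧
      ‖xstar‖ * (∑ j ∈ Finset.range m0, vabs j) ≤ ∑ i, xstar i * v i := by
  obtain ⟨hm1, hmn⟩ := Finset.mem_Icc.1 hm0mem
  have hvi : ∀ i : Fin n, vabs i = |v i| := fun i => by simp [hvabs]
  have hk : m0 - 1 < n := by omega
  have hApred : A (m0 - 1) ≤ r := by
    by_contra! h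
    rcases Nat.eq_zero_or_pos (m0 - 1) with h0 | h0
    · rw [h0, hA] at h
      simp at h
      linarith
    · have := hm0min (m0 - 1) (Finset.mem_Icc.2 ⟨h0, hk.le⟩) h
      omega
  have hsum : ∑ j ∈ Finset.range m0, vabs j = ∑ i : Fin n with i.val < m0, |v i| := by
    simp only [← sum_filter_lt_eq_sum_range hmn, hvi]
  rw [hsum]
  refine exists_minimizer_flat hp (fun i j hij => hsort i j hij) hr0 hr1
    ⟨⟨m0 - 1, hk⟩, ?_⟩ ?_ (b := vabs (m0 - 1)) ?_ ?_
  · simp; omega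
  · intro i hi j hj
    simp only [Finset.mem_filter, Finset.mem_univ, true_and] at hi hj
    exact Fin.le_def.2 (by omega)
  · intro i hi
    simp only [Finset.mem_filter, Finset.mem_univ, true_and] at hi
    rw [hvi ⟨m0 - 1, hk⟩]
    exact hsort _ _ (Fin.le_def.2 (by simp; omega))
  · simp only [← hvi]
    rw [sum_filter_lt_eq_sum_range hmn (fun j => vabs j - vabs (m0 - 1))]
    obtain ⟨k, rfl⟩ : ∃ k, m0 = k + 1 := ⟨m0 - 1, by omega⟩
    rw [Finset.sum_range_succ]
    simpa [hA] using hApred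
end
end

section
/- Assume d_i > 0 for every i (so vol(V) > 0). Let x ∈ ℝⁿ, x ≠ 0, satisfy |x_i| = ‖x‖_∞ for every i, set r = F(x), and assume that x_i·s_i ≥ 0 for every i and every subgradient s ∈ ∂Q_r(x) (i.e. x/‖x‖_∞ ∈ Sgn(s) for all s ∈ ∂Q_r(x)). Then: (a) for every i, F(R_i x) ≤ F(x), where R_i x is obtained from x by flipping the sign of the i-th coordinate; and (b) x is a local maximizer of F on the neighborhood U(x): F(y) ≤ F(x) for every y ≠ 0 with ‖y/‖y‖_∞ − x/‖x‖_∞‖_∞ < 1/2. -/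
open Finset

noncomputable section

/-- A sum over ordered pairs of a symmetric function vanishing on the diagonal is twice the sum
over increasing pairs. -/
theorem two_mul_sum_lt {n : ℕ} (f : Fin n → Fin n → ℝ) (hs : ∀ i j, f i j = f j i)
    (h0 : ∀ i, f i i = 0) :
    2 * (∑ i, ∑ j, if i < j then f i j else 0) = ∑ i, ∑ j, f i j := by
  have h1 : (∑ i, ∑ j, if i < j then f i j else 0) = ∑ i, ∑ j, if j < i then f i j else 0 := by
    rw [Finset.sum_comm]
    exact Finset.sum_congr rfl fun i _ => Finset.sum_congr rfl fun j _ => by rw [hs j i]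
  rw [two_mul]
  nth_rewrite 2 [h1]
  simp only [← Finset.sum_add_distrib]
  refine Finset.sum_congr rfl fun i _ => Finset.sum_congr rfl fun j _ => ?_
  rcases lt_trichotomy i j with h | h | h
  · simp [h, h.not_gt]
  · subst h; simp [h0]
  · simp [h, h.not_gt]

theorem two_mul_Ifun {n : ℕ} {w : Fin n → Fin n → ℝ} (hsymm : ∀ i j, w i j = w j i)
    (u : Fin n → ℝ) : 2 * Ifun n w u = ∑ i, ∑ j, w i j * |u i - u j| :=
  two_mul_sum_lt (fun i j => w i j * |u i - u j|)
    (fun i j => by rw [hsymm i j, abs_sub_comm]) (fun i => by simp)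

/-- A real multiplied by the sign of another real is at most its absolute value. -/
theorem sign_mul_le_abs (a b : ℝ) : Real.sign a * b ≤ |b| := by
  rcases Real.sign_apply_eq a with h | h | h <;> rw [h]
  · linarith [neg_abs_le b]
  · simp
  · linarith [le_abs_self b]

/-- A linear functional below `Ifun` that touches it at every vector ordered compatibly
with `z`. -/
theorem exists_Ifun_support {n : ℕ} {w : Fin n → Fin n → ℝ} (hsymm : ∀ i j, w i j = w j i)
    (hnn : ∀ i j, 0 ≤ w i j) (z : Fin n → ℝ) :
    ∃ s : Fin n → ℝ, (∀ u, ∑ i, s i * u i ≤ Ifun n w u) ∧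
      ∀ u : Fin n → ℝ, (∀ i j, u j < u i → z j < z i) → ∑ i, s i * u i = Ifun n w u := by
  have key : ∀ u : Fin n → ℝ, 2 * ∑ i, (∑ j, w i j * Real.sign (z i - z j)) * u i
      = ∑ i, ∑ j, w i j * (Real.sign (z i - z j) * (u i - u j)) := by
    intro u
    have h1 : ∑ i, (∑ j, w i j * Real.sign (z i - z j)) * u i
        = ∑ i, ∑ j, -(w i j * Real.sign (z i - z j) * u j) := by
      simp only [Finset.sum_mul]
      rw [Finset.sum_comm]
      refine Finset.sum_congr rfl fun i _ => Finset.sum_congr rfl fun j _ => ?_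
      rw [hsymm j i, ← neg_sub (z i) (z j), Real.sign_neg]
      ring
    rw [two_mul]
    nth_rewrite 2 [h1]
    simp only [Finset.sum_mul, ← Finset.sum_add_distrib]
    exact Finset.sum_congr rfl fun i _ => Finset.sum_congr rfl fun j _ => by ring
  refine ⟨fun i => ∑ j, w i j * Real.sign (z i - z j), fun u => ?_, fun u hu => ?_⟩
  · have h : 2 * ∑ i, (∑ j, w i j * Real.sign (z i - z j)) * u i ≤ 2 * Ifun n w u := by
      rw [key, two_mul_Ifun hsymm]
      exact Finset.sum_le_sum fun i _ => Finset.sum_le_sum fun j _ =>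
        mul_le_mul_of_nonneg_left (sign_mul_le_abs _ _) (hnn i j)
    linarith
  · have h : 2 * ∑ i, (∑ j, w i j * Real.sign (z i - z j)) * u i = 2 * Ifun n w u := by
      rw [key, two_mul_Ifun hsymm]
      refine Finset.sum_congr rfl fun i _ => Finset.sum_congr rfl fun j _ => ?_
      rcases lt_trichotomy (u i) (u j) with h | h | h
      · rw [Real.sign_of_neg (sub_neg.2 (hu j i h)), abs_of_neg (sub_neg.2 h)]
        ring
      · simp [h]
      · rw [Real.sign_of_pos (sub_pos.2 (hu i j h)), abs_of_pos (sub_pos.2 h)]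
        ring
    linarith

/-- Existence of a weighted median. -/
theorem exists_weighted_median {n : ℕ} (hn : 1 ≤ n) {d : Fin n → ℝ} (hd : ∀ i, 0 < d i)
    (z : Fin n → ℝ) :
    ∃ m, 2 * ∑ i with z i < z m, d i ≤ ∑ i, d i ∧ 2 * ∑ i with z m < z i, d i ≤ ∑ i, d i := by
  have : Nonempty (Fin n) := ⟨⟨0, hn⟩⟩
  have hne : (univ.filter fun m => 2 * ∑ i with z i < z m, d i ≤ ∑ i, d i).Nonempty := by
    obtain ⟨m, hm⟩ := Finite.exists_min z
    refine ⟨m, Finset.mem_filter.2 ⟨Finset.mem_univ _, ?_⟩⟩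
    rw [Finset.filter_false_of_mem fun i _ => (hm i).not_gt]
    simpa using Finset.sum_nonneg fun i _ => (hd i).le
  obtain ⟨m, hm, hmax⟩ := Finset.exists_max_image _ z hne
  refine ⟨m, (Finset.mem_filter.1 hm).2, ?_⟩
  by_contra! hlt
  have hne' : (univ.filter fun i => z m < z i).Nonempty := by
    by_contra h
    rw [Finset.not_nonempty_iff_eq_empty] at h
    rw [h] at hlt
    have := Finset.sum_nonneg fun i (_ : i ∈ univ) => (hd i).le
    simp at hlt
    linarith
  obtain ⟨k, hk, hmin⟩ := Finset.exists_min_image _ z hne'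
  have hmk : z m < z k := (Finset.mem_filter.1 hk).2
  have heq : (univ.filter fun i => z i < z k) = univ.filter fun i => ¬ z m < z i := by
    ext i
    simp only [Finset.mem_filter, Finset.mem_univ, true_and, not_lt]
    refine ⟨fun h => ?_, fun h => h.trans_lt hmk⟩
    by_contra! h'
    exact (hmin i (Finset.mem_filter.2 ⟨Finset.mem_univ _, h'⟩)).not_gt h
  have hsum := Finset.sum_filter_add_sum_filter_not univ (fun i => z m < z i) d
  have hkm : k ∈ univ.filter fun m => 2 * ∑ i with z i < z m, d i ≤ ∑ i, d i := by
    refine Finset.mem_filter.2 ⟨Finset.mem_univ _, ?_⟩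
    rw [heq]
    linarith
  exact (hmax k hkm).not_gt hmk

theorem bddBelow_range_sum_abs {n : ℕ} {d : Fin n → ℝ} (hd : ∀ i, 0 < d i) (u : Fin n → ℝ) :
    BddBelow (Set.range fun c : ℝ => ∑ i, d i * |u i - c|) :=
  ⟨0, by
    rintro _ ⟨c, rfl⟩
    exact Finset.sum_nonneg fun i _ => mul_nonneg (hd i).le (abs_nonneg _)⟩

theorem Nfun_le {n : ℕ} {d : Fin n → ℝ} (hd : ∀ i, 0 < d i) (u : Fin n → ℝ) (c : ℝ) :
    Nfun n d u ≤ ∑ i, d i * |u i - c| :=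
  csInf_le (bddBelow_range_sum_abs hd u) ⟨c, rfl⟩

/-- A linear functional below `Nfun` that touches it at every vector ordered compatibly
with `z`. -/
theorem exists_Nfun_support {n : ℕ} (hn : 1 ≤ n) {d : Fin n → ℝ} (hd : ∀ i, 0 < d i)
    (z : Fin n → ℝ) :
    ∃ s : Fin n → ℝ, (∀ u, ∑ i, s i * u i ≤ Nfun n d u) ∧
      ∀ u : Fin n → ℝ, (∀ i j, u j < u i → z j < z i) → ∑ i, s i * u i = Nfun n d u := by
  obtain ⟨m, hL, hU⟩ := exists_weighted_median hn hd z
  set L := ∑ i with z i < z m, d i with hLdef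
  set U := ∑ i with z m < z i, d i with hUdef
  set E := ∑ i with z i = z m, d i with hEdef
  have hE : 0 < E := Finset.sum_pos (fun i _ => hd i) ⟨m, by simp⟩
  have hpart : ∀ a b c : ℝ, ∑ i, d i * (if z i < z m then a else if z m < z i then b else c)
      = a * L + b * U + c * E := by
    intro a b c
    rw [hLdef, hUdef, hEdef, Finset.sum_filter, Finset.sum_filter, Finset.sum_filter,
      Finset.mul_sum, Finset.mul_sum, Finset.mul_sum, ← Finset.sum_add_distrib,
      ← Finset.sum_add_distrib]
    refine Finset.sum_congr rfl fun i _ => ?_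
    rcases lt_trichotomy (z i) (z m) with h | h | h
    · simp [h, h.not_gt, h.ne, mul_comm]
    · simp [h, mul_comm]
    · simp [h, h.not_gt, h.ne', mul_comm]
  have htot : ∑ i, d i = L + U + E := by simpa using hpart 1 1 1
  set p : Fin n → ℝ := fun i => if z i < z m then -1 else if z m < z i then 1 else (L - U) / E
    with hp
  have hp0 : ∑ i, d i * p i = 0 := by
    rw [hp, hpart]
    field_simp
    ring
  have hp1 : ∀ i, |p i| ≤ 1 := by
    intro i
    simp only [hp]
    split_ifs
    · simp
    · simp
    · rw [abs_div, abs_of_pos hE, div_le_one hE, abs_le]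
      constructor <;> linarith
  have hshift : ∀ (u : Fin n → ℝ) (c : ℝ),
      ∑ i, d i * p i * u i = ∑ i, d i * (p i * (u i - c)) := by
    intro u c
    have : ∑ i, d i * (p i * (u i - c)) = ∑ i, d i * p i * u i - (∑ i, d i * p i) * c := by
      rw [Finset.sum_mul, ← Finset.sum_sub_distrib]
      exact Finset.sum_congr rfl fun i _ => by ring
    rw [this, hp0]
    ring
  have hle : ∀ u, ∑ i, d i * p i * u i ≤ Nfun n d u := by
    intro u
    refine le_csInf (Set.range_nonempty _) ?_
    rintro _ ⟨c, rfl⟩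
    rw [hshift u c]
    refine Finset.sum_le_sum fun i _ => mul_le_mul_of_nonneg_left ?_ (hd i).le
    calc p i * (u i - c) ≤ |p i * (u i - c)| := le_abs_self _
      _ = |p i| * |u i - c| := abs_mul _ _
      _ ≤ |u i - c| := mul_le_of_le_one_left (abs_nonneg _) (hp1 i)
  refine ⟨fun i => d i * p i, hle, fun u hu => le_antisymm (hle u) ?_⟩
  rw [hshift u (u m)]
  refine (Nfun_le hd u (u m)).trans_eq (Finset.sum_congr rfl fun i _ => ?_)
  congr 1
  rcases lt_trichotomy (u i) (u m) with h | h | h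
  · rw [abs_of_neg (sub_neg.2 h)]
    simp [hp, hu m i h]
  · simp [h]
  · rw [abs_of_pos (sub_pos.2 h)]
    simp [hp, hu i m h, (hu i m h).not_gt]

/-- The denominator of `Ffun` is positive away from zero. -/
theorem Ffun_denom_pos {n : ℕ} (hn : 1 ≤ n) {w : Fin n → Fin n → ℝ}
    (hd : ∀ i, 0 < dvec n w i) {y : Fin n → ℝ} (hy : y ≠ 0) :
    0 < 2 * vol n w univ * ‖y‖ - Nfun n (dvec n w) y := by
  have hvol : 0 < vol n w univ := Finset.sum_pos (fun i _ => hd i) ⟨⟨0, hn⟩, Finset.mem_univ _⟩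
  have h : Nfun n (dvec n w) y ≤ vol n w univ * ‖y‖ := by
    refine (Nfun_le hd y 0).trans ?_
    rw [vol, Finset.sum_mul]
    refine Finset.sum_le_sum fun i _ => mul_le_mul_of_nonneg_left ?_ (hd i).le
    simpa using norm_le_pi_norm y i
  nlinarith [mul_pos hvol (norm_pos_iff.2 hy)]

theorem Ifun_nonneg {n : ℕ} {w : Fin n → Fin n → ℝ} (hnn : ∀ i j, 0 ≤ w i j)
    (y : Fin n → ℝ) : 0 ≤ Ifun n w y := by
  refine Finset.sum_nonneg fun i _ => Finset.sum_nonneg fun j _ => ?_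
  split_ifs
  · exact mul_nonneg (hnn i j) (abs_nonneg _)
  · exact le_rfl

/-- If every subgradient of `Qfun` at the sign-type vector `x` is sign-compatible with `x`, then
`x` maximizes `Ffun` among the nonzero vectors that do not reverse the order of `x`. -/
theorem Ffun_le_of_comonotone {n : ℕ} (hn : 1 ≤ n) {w : Fin n → Fin n → ℝ}
    (hsymm : ∀ i j, w i j = w j i) (hnn : ∀ i j, 0 ≤ w i j) (hd : ∀ i, 0 < dvec n w i)
    {x : Fin n → ℝ} (hx : x ≠ 0) (hxall : ∀ i, |x i| = ‖x‖)
    (hsg : ∀ s ∈ subgrad n (Qfun n w (Ffun n w x)) x, ∀ i, 0 ≤ x i * s i)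
    {y : Fin n → ℝ} (hy : y ≠ 0) (hxy : ∀ i j, x j < x i → y j ≤ y i) :
    Ffun n w y ≤ Ffun n w x := by
  have hvol : 0 < vol n w univ := Finset.sum_pos (fun i _ => hd i) ⟨⟨0, hn⟩, Finset.mem_univ _⟩
  have hdx := Ffun_denom_pos hn hd hx
  have hdy := Ffun_denom_pos hn hd hy
  have hxpos : 0 < ‖x‖ := norm_pos_iff.2 hx
  set r := Ffun n w x with hr
  have hr0 : 0 ≤ r := div_nonneg (Ifun_nonneg hnn x) hdx.le
  have hIx : Ifun n w x = r * (2 * vol n w univ * ‖x‖ - Nfun n (dvec n w) x) := by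
    rw [hr, Ffun, div_mul_cancel₀ _ hdx.ne']
  obtain ⟨s, hs, hs'⟩ := exists_Ifun_support hsymm hnn (x + y)
  obtain ⟨t, ht, ht'⟩ := exists_Nfun_support hn hd (x + y)
  have hcx : ∀ i j, x j < x i → (x + y) j < (x + y) i := fun i j h =>
    add_lt_add_of_lt_of_le h (hxy i j h)
  have hcy : ∀ i j, y j < y i → (x + y) j < (x + y) i := fun i j h =>
    add_lt_add_of_le_of_lt (le_of_not_gt fun h' => (hxy j i h').not_gt h) h
  have hlin : ∀ u : Fin n → ℝ,
      ∑ i, (s i + r * t i) * u i = ∑ i, s i * u i + r * ∑ i, t i * u i := by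
    intro u
    rw [Finset.mul_sum, ← Finset.sum_add_distrib]
    exact Finset.sum_congr rfl fun i _ => by ring
  have hmem : (fun i => (s i + r * t i) / (2 * vol n w univ)) ∈ subgrad n (Qfun n w r) x := by
    intro u
    have h1 : ∑ i, (s i + r * t i) / (2 * vol n w univ) * (u i - x i)
        = (∑ i, (s i + r * t i) * u i - ∑ i, (s i + r * t i) * x i) / (2 * vol n w univ) := by
      rw [← Finset.sum_sub_distrib, Finset.sum_div]
      exact Finset.sum_congr rfl fun i _ => by ring
    rw [h1, Qfun, Qfun, ← add_div, ge_iff_le]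
    refine div_le_div_of_nonneg_right ?_ (by linarith)
    rw [hlin, hlin, hs' x hcx, ht' x hcx]
    linarith [hs u, mul_le_mul_of_nonneg_left (ht u) hr0]
  have hsign : ∀ i, 0 ≤ x i * (s i + r * t i) := by
    intro i
    have h := hsg _ hmem i
    rwa [← mul_div_assoc, le_div_iff₀ (by linarith), zero_mul] at h
  have hterm : ∀ i, (s i + r * t i) * (‖x‖ * y i) ≤ (s i + r * t i) * (‖y‖ * x i) := by
    intro i
    have hyi : |y i| ≤ ‖y‖ := norm_le_pi_norm y i
    have hsi := hsign i
    rcases (abs_eq hxpos.le).1 (hxall i) with h | h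
    · rw [h] at hsi ⊢
      rw [mul_comm ‖y‖]
      exact mul_le_mul_of_nonneg_left
        (mul_le_mul_of_nonneg_left ((le_abs_self _).trans hyi) hxpos.le)
        (nonneg_of_mul_nonneg_right hsi hxpos)
    · rw [h] at hsi ⊢
      have hneg : s i + r * t i ≤ 0 := by
        by_contra! hc
        nlinarith [mul_pos hxpos hc]
      refine mul_le_mul_of_nonpos_left ?_ hneg
      nlinarith [neg_abs_le (y i)]
  have hsum := Finset.sum_le_sum fun i (_ : i ∈ univ) => hterm i
  have hpull : ∀ (c : ℝ) (u : Fin n → ℝ), ∑ i, (s i + r * t i) * (c * u i)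
      = c * (∑ i, s i * u i + r * ∑ i, t i * u i) := by
    intro c u
    rw [← hlin, Finset.mul_sum]
    exact Finset.sum_congr rfl fun i _ => by ring
  rw [hpull, hpull, hs' x hcx, ht' x hcx, hs' y hcy, ht' y hcy, hIx] at hsum
  have hfin : Ifun n w y + r * Nfun n (dvec n w) y ≤ r * (2 * vol n w univ * ‖y‖) := by
    refine le_of_mul_le_mul_left ?_ hxpos
    linarith
  rw [Ffun, div_le_iff₀ hdy]
  linarith

/-- if `|x_i| = ‖x‖_∞` for all `i`, `r = F(x)` and every subgradient
`s ∈ ∂Q_r(x)` satisfies `x_i s_i ≥ 0` for all `i`, then flipping any one sign does not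
increase `F`, and `x` is a local maximizer of `F` on the neighborhood
`U(x) = {y ≠ 0 : ‖y/‖y‖_∞ - x/‖x‖_∞‖_∞ < 1/2}`. -/
theorem stmt18 (n : ℕ) (hn : 1 ≤ n) (w : Fin n → Fin n → ℝ)
    (hsymm : ∀ i j, w i j = w j i) (hnn : ∀ i j, 0 ≤ w i j)
    (hdiag : ∀ i, w i i = 0) (hd : ∀ i, 0 < dvec n w i)
    (x : Fin n → ℝ) (hx : x ≠ 0) (hxall : ∀ i, |x i| = ‖x‖)
    (r : ℝ) (hr : r = Ffun n w x)
    (hsg : ∀ s ∈ subgrad n (Qfun n w r) x, ∀ i, 0 ≤ x i * s i) :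
    (∀ i : Fin n, Ffun n w (Function.update x i (-x i)) ≤ Ffun n w x) ∧
    (∀ y : Fin n → ℝ, y ≠ 0 → ‖‖y‖⁻¹ • y - ‖x‖⁻¹ • x‖ < 1 / 2 →
      Ffun n w y ≤ Ffun n w x) := by
  subst hr
  have hxpos : 0 < ‖x‖ := norm_pos_iff.2 hx
  have hval : ∀ i, x i = ‖x‖ ∨ x i = -‖x‖ := fun i => (abs_eq hxpos.le).1 (hxall i)
  have hlt : ∀ i j, x j < x i → x i = ‖x‖ ∧ x j = -‖x‖ := by
    intro i j h
    rcases hval i with h1 | h1 <;> rcases hval j with h2 | h2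
    · linarith
    · exact ⟨h1, h2⟩
    · linarith
    · linarith
  refine ⟨fun i => ?_, fun y hy hxy => ?_⟩
  · refine Ffun_le_of_comonotone hn hsymm hnn hd hx hxall hsg ?_ fun k l h => ?_
    · intro h0
      have h1 := congrFun h0 i
      rw [Function.update_self] at h1
      have h2 := hxall i
      rw [neg_eq_zero.1 h1] at h2
      simp at h2
      exact hx (norm_eq_zero.1 h2.symm)
    · obtain ⟨hk, hl⟩ := hlt k l h
      have hkl : k ≠ l := fun e => h.ne (by rw [e])
      by_cases hki : k = i
      · subst hki
        rw [Function.update_self, Function.update_of_ne hkl.symm, hk, hl]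
      · rw [Function.update_of_ne hki]
        by_cases hli : l = i
        · subst hli
          rw [Function.update_self, hk, hl, neg_neg]
        · rw [Function.update_of_ne hli]
          exact h.le
  · refine Ffun_le_of_comonotone hn hsymm hnn hd hx hxall hsg hy fun k l h => ?_
    obtain ⟨hk, hl⟩ := hlt k l h
    have hypos : 0 < ‖y‖ := norm_pos_iff.2 hy
    have hclose : ∀ i, |‖y‖⁻¹ * y i - ‖x‖⁻¹ * x i| < 1 / 2 := fun i =>
      (norm_le_pi_norm (‖y‖⁻¹ • y - ‖x‖⁻¹ • x) i).trans_lt hxy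
    have h1 := (abs_lt.1 (hclose k)).1
    have h2 := (abs_lt.1 (hclose l)).2
    rw [hk, inv_mul_cancel₀ hxpos.ne'] at h1
    rw [hl, mul_neg, inv_mul_cancel₀ hxpos.ne'] at h2
    refine le_of_mul_le_mul_left ?_ (inv_pos.2 hypos)
    linarith
end
end
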